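/- For every partition α and every nonnegative integer n: Σ_{λ : λ/α ⊢ n} f^{λ/α}(q) = Σ_{k ≥ 0} [n choose k]_q · t_k(q) · Σ_{μ : α/μ ⊢ n-k} f^{α/μ}(q), where the left sum is over partitions λ ⊇ α with |λ| - |α| = n, and the inner right sum is over partitions μ ⊆ α with |α| - |μ| = n - k. -/

import Mathlib

open Finset

namespace QT

/-- The major index of a permutation of `Fin n` (sum of descents,
with positions written `1,...,n-1` as in one-line notation). -/
def maj {n : ℕ} (π : Equiv.Perm (Fin n)) : ℕ :=
  ∑ i ∈ Finset.range n,
    if h : i + 1 < n then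
      (if π ⟨i + 1, h⟩ < π ⟨i, by omega⟩ then i + 1 else 0)
    else 0

/-- `imaj π = maj π⁻¹`. -/
def imaj {n : ℕ} (π : Equiv.Perm (Fin n)) : ℕ := maj π⁻¹

/-- The permutation of `Fin k` order-isomorphic to the word `v 0, v 1, ..., v (k-1)`. -/
noncomputable def standardize {n k : ℕ} (v : Fin k → Fin n) (hv : Function.Injective v) :
    Equiv.Perm (Fin k) :=
  Equiv.ofBijective
    (fun i => (Finset.orderIsoOfFin (Finset.image v Finset.univ)
        (by rw [Finset.card_image_of_injective _ hv, Finset.card_univ, Fintype.card_fin])).symm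
        ⟨v i, Finset.mem_image_of_mem v (Finset.mem_univ i)⟩)
    (Finite.injective_iff_bijective.mp (fun i j hij => by
      have h2 := (Finset.orderIsoOfFin _ _).symm.injective hij
      exact hv (congrArg Subtype.val h2)))

/-- `π^{≤k}` : the permutation of `Fin k` order-isomorphic to the first `k` letters of `π`. -/
noncomputable def pInit {n : ℕ} (π : Equiv.Perm (Fin n)) (k : ℕ) (hk : k ≤ n) :
    Equiv.Perm (Fin k) :=
  standardize (fun i => π (Fin.castLE hk i))
    (fun i j h => Fin.castLE_injective hk (π.injective h))

/-- `π^{>k}` : the permutation of `Fin (n-k)` order-isomorphic to the last `n - k` letters of `π`. -/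
noncomputable def pTail {n : ℕ} (π : Equiv.Perm (Fin n)) (k : ℕ) :
    Equiv.Perm (Fin (n - k)) :=
  standardize (fun i => π ⟨k + (i : ℕ), by have := i.isLt; omega⟩)
    (fun i j h => by
      have h2 : k + (i : ℕ) = k + (j : ℕ) := congrArg Fin.val (π.injective h)
      exact Fin.ext (by omega))

/-- `π_{≤k}` : the permutation of `Fin k` order-isomorphic to the subword of `π`
consisting of the `k` smallest values.  (Equivalently `((π⁻¹)^{≤k})⁻¹`.) -/
noncomputable def vLow {n : ℕ} (π : Equiv.Perm (Fin n)) (k : ℕ) (hk : k ≤ n) :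
    Equiv.Perm (Fin k) := (pInit π⁻¹ k hk)⁻¹

/-- `π_{>k}` : the permutation of `Fin (n-k)` order-isomorphic to the subword of `π`
consisting of the values `> k`.  (Equivalently `((π⁻¹)^{>k})⁻¹`.) -/
noncomputable def vHigh {n : ℕ} (π : Equiv.Perm (Fin n)) (k : ℕ) :
    Equiv.Perm (Fin (n - k)) := (pTail π⁻¹ k)⁻¹

/-- The set `I_n` of involutions in `S_n`. -/
def involutions (n : ℕ) : Finset (Equiv.Perm (Fin n)) :=
  Finset.univ.filter fun π => π * π = 1

-- `I_n(σ) = {π ∈ I_n : π_{≤m} = σ}`.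
open scoped Classical in
noncomputable def involutionsC (n : ℕ) {m : ℕ} (σ : Equiv.Perm (Fin m)) :
    Finset (Equiv.Perm (Fin n)) :=
  (involutions n).filter fun π => ∃ h : m ≤ n, vLow π m h = σ

-- `S_n(σ,τ) = {π ∈ S_n : π_{≤a} = σ, π^{≤b} = τ}`.
open scoped Classical in
noncomputable def permsC (n : ℕ) {a b : ℕ} (σ : Equiv.Perm (Fin a)) (τ : Equiv.Perm (Fin b)) :
    Finset (Equiv.Perm (Fin n)) :=
  Finset.univ.filter fun π => ∃ (ha : a ≤ n) (hb : b ≤ n), vLow π a ha = σ ∧ pInit π b hb = τ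

-- The j-set `J(σ) = {j : σ^{≤j} is an involution}`.
open scoped Classical in
noncomputable def jSet {m : ℕ} (σ : Equiv.Perm (Fin m)) : Finset ℕ :=
  (Finset.range (m + 1)).filter fun j => ∃ h : j ≤ m, pInit σ j h * pInit σ j h = 1

-- The j₂-set `J(σ,τ) = {j : σ^{≤j} = τ_{≤j}}`.
open scoped Classical in
noncomputable def j2Set {a b : ℕ} (σ : Equiv.Perm (Fin a)) (τ : Equiv.Perm (Fin b)) :
    Finset ℕ :=
  (Finset.range (min a b + 1)).filter fun j =>
    ∃ (ha : j ≤ a) (hb : j ≤ b), pInit σ j ha = vLow τ j hb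

/-- A set of nonnegative integers is a j₂-set if it is `J(σ,τ)` for some pair of
permutations. -/
def IsJ2Set (S : Finset ℕ) : Prop :=
  ∃ (a b : ℕ) (σ : Equiv.Perm (Fin a)) (τ : Equiv.Perm (Fin b)), S = j2Set σ τ

-- The number of j₂-sets with largest element `n`.
open scoped Classical in
noncomputable def j2count (n : ℕ) : ℕ :=
  ((Finset.range (n + 1)).powerset.filter
    fun S => IsJ2Set S ∧ n ∈ S ∧ ∀ x ∈ S, x ≤ n).card

/-- `[n]_q = 1 + q + ⋯ + q^{n-1}`. -/
def qInt (q : ℝ) (n : ℕ) : ℝ := ∑ i ∈ Finset.range n, q ^ i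

/-- The q-factorial `[n]_q! = ∏_{i=1}^n (1 + q + ⋯ + q^{i-1})`. -/
def qFact (q : ℝ) (n : ℕ) : ℝ := ∏ i ∈ Finset.range n, qInt q (i + 1)

/-- The Gaussian binomial coefficient `[n choose k]_q = [n]_q!/([k]_q! [n-k]_q!)`,
defined via the q-Pascal recursion. -/
def qBinom (q : ℝ) : ℕ → ℕ → ℝ
  | _, 0 => 1
  | 0, _ + 1 => 0
  | n + 1, k + 1 => qBinom q n k + q ^ (k + 1) * qBinom q n (k + 1)

/-- `t_n(q) = Σ_{π ∈ I_n} q^{maj π}`. -/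
noncomputable def tq (q : ℝ) (n : ℕ) : ℝ := ∑ π ∈ involutions n, q ^ maj π

/-- `A_n(p,q) = Σ_{π ∈ S_n} p^{imaj π} q^{maj π}`. -/
noncomputable def Apq (p q : ℝ) (n : ℕ) : ℝ :=
  ∑ π : Equiv.Perm (Fin n), p ^ imaj π * q ^ maj π



/-- The `k × k` square Young diagram. -/
def square (k : ℕ) : YoungDiagram :=
  ⟨Finset.range k ×ˢ Finset.range k, by
    intro a b hab ha
    rw [Finset.mem_coe, Finset.mem_product] at ha ⊢
    simp only [Finset.mem_range] at ha ⊢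
    exact ⟨lt_of_le_of_lt hab.1 ha.1, lt_of_le_of_lt hab.2 ha.2⟩⟩

-- All Young diagrams contained in `l`.
open scoped Classical in
noncomputable def subDiagrams (l : YoungDiagram) : Finset YoungDiagram :=
  (l.cells.powerset.filter fun (s : Finset (ℕ × ℕ)) => IsLowerSet ((s : Set (ℕ × ℕ)))).attach.image
    fun s => YoungDiagram.mk s.1 (by
      have hs := s.2
      rw [Finset.mem_filter] at hs
      exact hs.2)

/-- All Young diagrams with `k` cells (i.e. partitions of `k`). -/
noncomputable def diagramsOfCard (k : ℕ) : Finset YoungDiagram :=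
  (subDiagrams (square k)).filter fun d => d.card = k

/-- A chain of Young diagrams each obtained from the previous by adding one cell.
Such chains of length `n` starting at `μ` and ending at `λ` are exactly the skew standard
Young tableaux of shape `λ/μ` with `n` cells. -/
def IsSYTChain {n : ℕ} (c : Fin (n + 1) → YoungDiagram) : Prop :=
  ∀ i : ℕ, ∀ _h : i < n,
    c ⟨i, by omega⟩ ≤ c ⟨i + 1, by omega⟩ ∧
      (c ⟨i + 1, by omega⟩).card = (c ⟨i, by omega⟩).card + 1

-- The (skew) standard Young tableaux of shape `λ/μ` and size `n`, encoded as chains.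
open scoped Classical in
noncomputable def skewSYT (mu lam : YoungDiagram) (n : ℕ) :
    Finset (Fin (n + 1) → YoungDiagram) :=
  (Fintype.piFinset fun _ : Fin (n + 1) => subDiagrams lam).filter
    fun c => c 0 = mu ∧ c (Fin.last n) = lam ∧ IsSYTChain c

-- `T_n` : all standard Young tableaux of size `n` (encoded as chains starting at `⊥`).
open scoped Classical in
noncomputable def allSYT (n : ℕ) : Finset (Fin (n + 1) → YoungDiagram) :=
  (Fintype.piFinset fun _ : Fin (n + 1) => subDiagrams (square n)).filter
    fun c => c 0 = ⊥ ∧ IsSYTChain c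

/-- The row in which the `(i+1)`-st cell of the chain `c` is added. -/
def rowOfStep {n : ℕ} (c : Fin (n + 1) → YoungDiagram) (i : ℕ) : ℕ :=
  if h : i < n then
    ((c ⟨i + 1, by omega⟩).cells \ (c ⟨i, by omega⟩).cells).sup Prod.fst
  else 0

/-- The major index of a (skew) standard Young tableau, encoded as a chain:
the sum of all `i` such that `i+1` lies in a lower row than `i`. -/
def chainMaj {n : ℕ} (c : Fin (n + 1) → YoungDiagram) : ℕ :=
  ∑ i ∈ Finset.range n,
    if i + 1 < n ∧ rowOfStep c i < rowOfStep c (i + 1) then i + 1 else 0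

/-- `f^{λ/μ}(q) = Σ_{sh(T) = λ/μ} q^{maj T}`, where `n` is the number of cells of `λ/μ`. -/
noncomputable def fSkew (mu lam : YoungDiagram) (n : ℕ) (q : ℝ) : ℝ :=
  ∑ c ∈ skewSYT mu lam n, q ^ chainMaj c

/-- `T_{>m}` : the skew tableau obtained from `T` by removing the entries `≤ m`. -/
def tailChain {n : ℕ} (c : Fin (n + 1) → YoungDiagram) (m : ℕ) :
    Fin (n - m + 1) → YoungDiagram :=
  fun i => c ⟨min (m + (i : ℕ)) n, by omega⟩

/-- `T` contains `A`, i.e. `T_{≤a} = A`. -/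
def containsT {n a : ℕ} (T : Fin (n + 1) → YoungDiagram)
    (A : Fin (a + 1) → YoungDiagram) : Prop :=
  ∀ i : Fin (a + 1), T ⟨min (i : ℕ) n, by omega⟩ = A i

-- `T_n(A,B)` : pairs of standard Young tableaux of the same shape, of size `n`,
-- containing `A` and `B` respectively.
open scoped Classical in
noncomputable def pairSYT (n : ℕ) {a b : ℕ} (A : Fin (a + 1) → YoungDiagram)
    (B : Fin (b + 1) → YoungDiagram) :
    Finset ((Fin (n + 1) → YoungDiagram) × (Fin (n + 1) → YoungDiagram)) :=
  ((allSYT n) ×ˢ (allSYT n)).filter fun PQ =>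
    PQ.1 (Fin.last n) = PQ.2 (Fin.last n) ∧ containsT PQ.1 A ∧ containsT PQ.2 B

/-- The empty standard Young tableau. -/
def emptySYT : Fin (0 + 1) → YoungDiagram := fun _ => ⊥

/-- Schensted row insertion: insert `x` into the row `r`, returning the new row and
the bumped entry (if any). -/
def insertRow : List ℕ → ℕ → List ℕ × Option ℕ
  | [], x => ([x], none)
  | y :: ys, x =>
    if x < y then (x :: ys, some y)
    else
      let p := insertRow ys x
      (y :: p.1, p.2)

/-- Schensted insertion of `x` into a tableau given as a list of rows. -/
def insertTab : List (List ℕ) → ℕ → List (List ℕ)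
  | [], x => [[x]]
  | r :: rs, x =>
    match insertRow r x with
    | (r', none) => r' :: rs
    | (r', some y) => r' :: insertTab rs y

/-- The Robinson–Schensted insertion tableau of a word. -/
def Ptab (w : List ℕ) : List (List ℕ) := w.foldl insertTab []

/-- The Young diagram with row lengths `r` (junk-robust version). -/
def diagramOfRows (r : List ℕ) : YoungDiagram :=
  ⟨(Finset.range r.length ×ˢ Finset.range (r.foldr max 0)).filter
      (fun p => ∀ i ≤ p.1, p.2 < r.getD i 0), by
    intro a b hab ha
    rw [Finset.mem_coe, Finset.mem_filter, Finset.mem_product] at ha ⊢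
    obtain ⟨⟨h1, h2⟩, h3⟩ := ha
    simp only [Finset.mem_range] at h1 h2 ⊢
    refine ⟨⟨lt_of_le_of_lt hab.1 h1, lt_of_le_of_lt hab.2 h2⟩, fun i hi => ?_⟩
    exact lt_of_le_of_lt hab.2 (h3 i (le_trans hi hab.1))⟩

/-- The shape of the Robinson–Schensted insertion tableau of a word. -/
def RSshape (w : List ℕ) : YoungDiagram := diagramOfRows ((Ptab w).map List.length)

/-- The one-line word of a permutation of `Fin a` (with values `0,…,a-1`). -/
def wordOf {a : ℕ} (σ : Equiv.Perm (Fin a)) : List ℕ :=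
  (List.finRange a).map fun i => (σ i : ℕ)

/-- The chain encoding of the Robinson–Schensted insertion tableau `P(σ)`:
its `i`-th diagram is the shape of the subtableau of `P(σ)` with entries `≤ i`,
which equals the RS-shape of the subword of `σ` with values `≤ i`. -/
def Pchain {a : ℕ} (σ : Equiv.Perm (Fin a)) : Fin (a + 1) → YoungDiagram :=
  fun i => RSshape ((wordOf σ).filter fun x => x < (i : ℕ))

/-- The chain encoding of the Robinson–Schensted recording tableau `Q(σ)`:
its `i`-th diagram is the shape of the subtableau of `Q(σ)` with entries `≤ i`,
which equals the RS-shape of the prefix of `σ` of length `i`. -/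
def Qchain {a : ℕ} (σ : Equiv.Perm (Fin a)) : Fin (a + 1) → YoungDiagram :=
  fun i => RSshape ((wordOf σ).take (i : ℕ))

theorem ext_rowLen {μ ν : YoungDiagram} (h : ∀ i, μ.rowLen i = ν.rowLen i) : μ = ν := by
  apply SetLike.ext
  rintro ⟨i, j⟩
  rw [YoungDiagram.mem_iff_lt_rowLen, YoungDiagram.mem_iff_lt_rowLen, h]

theorem le_iff_rowLen {μ ν : YoungDiagram} : μ ≤ ν ↔ ∀ i, μ.rowLen i ≤ ν.rowLen i := by
  constructor
  · intro h i
    by_contra! hlt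
    have h1 : (i, ν.rowLen i) ∈ μ := YoungDiagram.mem_iff_lt_rowLen.2 hlt
    exact absurd (YoungDiagram.mem_iff_lt_rowLen.1 (h h1)) (lt_irrefl _)
  · rintro h ⟨i, j⟩ hx
    exact YoungDiagram.mem_iff_lt_rowLen.2 ((YoungDiagram.mem_iff_lt_rowLen.1 hx).trans_le (h i))

theorem rowLen_eq_zero_of_le {μ : YoungDiagram} {N i : ℕ} (h : μ.rowLen N = 0) (hi : N ≤ i) :
    μ.rowLen i = 0 :=
  Nat.le_zero.1 (h ▸ μ.rowLen_anti N i hi)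

theorem exists_rowLen_eq_zero (μ : YoungDiagram) : ∃ N, μ.rowLen N = 0 := by
  refine ⟨μ.colLen 0, ?_⟩
  by_contra h
  have h1 : (μ.colLen 0, 0) ∈ μ := YoungDiagram.mem_iff_lt_rowLen.2 (Nat.pos_of_ne_zero h)
  exact absurd (YoungDiagram.mem_iff_lt_colLen.1 h1) (lt_irrefl _)

theorem card_eq_sum {μ : YoungDiagram} {N : ℕ} (h : μ.rowLen N = 0) :
    μ.card = ∑ i ∈ range N, μ.rowLen i := by
  have hm : ∀ c ∈ μ.cells, c.1 ∈ range N := by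
    rintro ⟨i, j⟩ hc
    rw [mem_range]
    by_contra! hle
    have := YoungDiagram.mem_iff_lt_rowLen.1 ((YoungDiagram.mem_cells _).1 hc)
    rw [rowLen_eq_zero_of_le h hle] at this
    exact absurd this (Nat.not_lt_zero _)
  rw [YoungDiagram.card, Finset.card_eq_sum_card_fiberwise hm]
  refine sum_congr rfl fun i _ => ?_
  rw [YoungDiagram.rowLen_eq_card]
  rfl

theorem card_mono {μ ν : YoungDiagram} (h : μ ≤ ν) : μ.card ≤ ν.card :=
  Finset.card_le_card (YoungDiagram.cells_subset_iff.2 h)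

theorem eq_of_le_of_card_le {μ ν : YoungDiagram} (h : μ ≤ ν) (hc : ν.card ≤ μ.card) : μ = ν :=
  YoungDiagram.ext (Finset.eq_of_subset_of_card_le (YoungDiagram.cells_subset_iff.2 h) hc)

/-- The Young diagram with the given weakly decreasing row lengths. -/
def ofFun (f : ℕ → ℕ) (hf : Antitone f) (N : ℕ) (_hN : f N = 0) : YoungDiagram :=
  ⟨(range N ×ˢ range (f 0)).filter fun p => p.2 < f p.1, by
    rintro ⟨a, b⟩ ⟨c, d⟩ ⟨h1, h2⟩ ha
    simp only [coe_filter, mem_product, mem_range, Set.mem_ofPred_eq] at ha h1 h2 ⊢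
    have := hf h1
    omega⟩

theorem rowLen_ofFun (f : ℕ → ℕ) (hf : Antitone f) (N : ℕ) (hN : f N = 0) (i : ℕ) :
    (ofFun f hf N hN).rowLen i = f i := by
  have key : ∀ j, j < (ofFun f hf N hN).rowLen i ↔ j < f i := by
    intro j
    rw [← YoungDiagram.mem_iff_lt_rowLen, ← YoungDiagram.mem_cells]
    simp only [ofFun, mem_filter, mem_product, mem_range]
    have h0 := hf (Nat.zero_le i)
    have h1 : N ≤ i → f i = 0 := fun h => Nat.le_zero.1 (hN ▸ hf h)
    constructor
    · exact fun h => h.2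
    · intro h
      refine ⟨⟨?_, by omega⟩, h⟩
      by_contra! hle
      have := h1 hle
      omega
  exact le_antisymm (le_of_not_gt fun h => lt_irrefl _ ((key _).1 h))
    (le_of_not_gt fun h => lt_irrefl _ ((key _).2 h))

theorem mem_subDiagrams {d l : YoungDiagram} : d ∈ subDiagrams l ↔ d ≤ l := by
  classical
  unfold subDiagrams
  rw [mem_image]
  constructor
  · rintro ⟨s, -, rfl⟩
    have := s.2
    rw [mem_filter, mem_powerset] at this
    exact YoungDiagram.cells_subset_iff.1 this.1
  · intro h
    refine ⟨⟨d.cells, ?_⟩, mem_attach _ _, rfl⟩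
    rw [mem_filter, mem_powerset]
    exact ⟨YoungDiagram.cells_subset_iff.2 h, d.isLowerSet⟩

theorem mem_diagramsOfCard {d : YoungDiagram} {k : ℕ} : d ∈ diagramsOfCard k ↔ d.card = k := by
  unfold diagramsOfCard
  rw [mem_filter, mem_subDiagrams, and_iff_right_iff_imp]
  rintro rfl
  rintro ⟨i, j⟩ hx
  change (i, j) ∈ (square d.card).cells
  simp only [square, mem_product, mem_range]
  have h1 : (range (i + 1)) ×ˢ {0} ⊆ d.cells := by
    rintro ⟨a, b⟩ h
    simp only [mem_product, mem_range, mem_singleton] at h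
    exact d.up_left_mem (by omega) (by omega) hx
  have h2 : {0} ×ˢ (range (j + 1)) ⊆ d.cells := by
    rintro ⟨a, b⟩ h
    simp only [mem_product, mem_range, mem_singleton] at h
    exact d.up_left_mem (by omega) (by omega) hx
  have h3 := card_le_card h1
  have h4 := card_le_card h2
  simp only [card_product, card_range, card_singleton] at h3 h4
  change _ ≤ d.card at h3
  change _ ≤ d.card at h4
  omega

/-- `l / m` is a horizontal strip. -/
def HStrip (m l : YoungDiagram) : Prop :=
  ∀ i, m.rowLen i ≤ l.rowLen i ∧ l.rowLen (i + 1) ≤ m.rowLen i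

theorem HStrip.le {m l : YoungDiagram} (h : HStrip m l) : m ≤ l :=
  le_iff_rowLen.2 fun i => (h i).1

theorem HStrip.refl (m : YoungDiagram) : HStrip m m :=
  fun i => ⟨le_rfl, m.rowLen_anti _ _ (Nat.le_succ i)⟩

open scoped Classical in
/-- The diagrams obtained from `m` by adding a horizontal strip of size `i`. -/
noncomputable def stripUp (m : YoungDiagram) (i : ℕ) : Finset YoungDiagram :=
  (diagramsOfCard (m.card + i)).filter fun l => HStrip m l

open scoped Classical in
/-- The diagrams obtained from `l` by removing a horizontal strip of size `j`. -/
noncomputable def stripDown (l : YoungDiagram) (j : ℕ) : Finset YoungDiagram :=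
  (subDiagrams l).filter fun m => HStrip m l ∧ m.card + j = l.card

theorem mem_stripUp {m l : YoungDiagram} {i : ℕ} :
    l ∈ stripUp m i ↔ HStrip m l ∧ l.card = m.card + i := by
  classical
  rw [stripUp, mem_filter, mem_diagramsOfCard, and_comm]

theorem mem_stripDown {m l : YoungDiagram} {j : ℕ} :
    m ∈ stripDown l j ↔ HStrip m l ∧ m.card + j = l.card := by
  classical
  rw [stripDown, mem_filter, mem_subDiagrams]
  exact ⟨fun h => h.2, fun h => ⟨h.1.le, h⟩⟩

/-- Row lengths of the diagram with top row `max a₀ b₀ + r` corresponding to `g` under the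
local Robinson–Schensted–Knuth rule. -/
def reflectFun (a b g : YoungDiagram) : ℕ → ℕ
  | 0 => max (a.rowLen 0) (b.rowLen 0)
  | k + 1 => max (a.rowLen (k + 1)) (b.rowLen (k + 1)) + min (a.rowLen k) (b.rowLen k) - g.rowLen k

/-- Inverse of `reflectFun`. -/
def reflectInvFun (a b l : YoungDiagram) (k : ℕ) : ℕ :=
  max (a.rowLen (k + 1)) (b.rowLen (k + 1)) + min (a.rowLen k) (b.rowLen k) - l.rowLen (k + 1)

theorem exists_common_rowLen_eq_zero (a b c : YoungDiagram) :
    ∃ N, a.rowLen N = 0 ∧ b.rowLen N = 0 ∧ c.rowLen N = 0 := by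
  obtain ⟨N₁, h₁⟩ := exists_rowLen_eq_zero a
  obtain ⟨N₂, h₂⟩ := exists_rowLen_eq_zero b
  obtain ⟨N₃, h₃⟩ := exists_rowLen_eq_zero c
  exact ⟨N₁ + N₂ + N₃, rowLen_eq_zero_of_le h₁ (by omega), rowLen_eq_zero_of_le h₂ (by omega),
    rowLen_eq_zero_of_le h₃ (by omega)⟩

/-- Existence part of the local rule, from below to above. -/
theorem exists_reflect {a b g : YoungDiagram} (ha : HStrip g a) (hb : HStrip g b) :
    ∃ l : YoungDiagram, ∀ k, l.rowLen k = reflectFun a b g k := by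
  obtain ⟨N, h1, h2, h3⟩ := exists_common_rowLen_eq_zero a b g
  have hanti : Antitone (reflectFun a b g) := by
    refine antitone_nat_of_succ_le fun k => ?_
    have e1 := ha k
    have e2 := hb k
    cases k with
    | zero => simp only [reflectFun]; omega
    | succ k =>
      have e3 := ha k
      have e4 := hb k
      simp only [reflectFun]
      omega
  have hz : reflectFun a b g (N + 1) = 0 := by
    have e1 := rowLen_eq_zero_of_le h1 (show N ≤ N + 1 by omega)
    have e2 := rowLen_eq_zero_of_le h2 (show N ≤ N + 1 by omega)
    simp only [reflectFun]
    omega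
  exact ⟨ofFun _ hanti _ hz, fun k => rowLen_ofFun _ _ _ _ _⟩

/-- Existence part of the local rule, from above to below. -/
theorem exists_reflectInv {a b l : YoungDiagram} (ha : HStrip a l) (hb : HStrip b l) :
    ∃ g : YoungDiagram, ∀ k, g.rowLen k = reflectInvFun a b l k := by
  obtain ⟨N, h1, h2, h3⟩ := exists_common_rowLen_eq_zero a b l
  have hanti : Antitone (reflectInvFun a b l) := by
    refine antitone_nat_of_succ_le fun k => ?_
    have e1 := ha k
    have e2 := hb k
    have e3 := ha (k + 1)
    have e4 := hb (k + 1)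
    have e5 := (ha (k + 1 + 1)).1
    have e6 := (hb (k + 1 + 1)).1
    simp only [reflectInvFun]
    omega
  have hz : reflectInvFun a b l N = 0 := by
    have e1 := rowLen_eq_zero_of_le h1 (show N ≤ N + 1 by omega)
    have e2 := rowLen_eq_zero_of_le h2 (show N ≤ N + 1 by omega)
    simp only [reflectInvFun]
    omega
  exact ⟨ofFun _ hanti _ hz, fun k => rowLen_ofFun _ _ _ _ _⟩

theorem card_add_card_reflect {a b g l : YoungDiagram} (ha : HStrip g a) (hb : HStrip g b)
    (hl : ∀ k, l.rowLen k = reflectFun a b g k) :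
    l.card + g.card = a.card + b.card := by
  obtain ⟨N, h1, h2, h3⟩ := exists_common_rowLen_eq_zero a b g
  have hz : l.rowLen (N + 1) = 0 := by
    have e1 := rowLen_eq_zero_of_le h1 (show N ≤ N + 1 by omega)
    have e2 := rowLen_eq_zero_of_le h2 (show N ≤ N + 1 by omega)
    rw [hl]
    simp only [reflectFun]
    omega
  rw [card_eq_sum hz, card_eq_sum h1, card_eq_sum h2, card_eq_sum h3, sum_range_succ']
  have hM : ∑ k ∈ range N, max (a.rowLen (k + 1)) (b.rowLen (k + 1)) +
      max (a.rowLen 0) (b.rowLen 0) = ∑ k ∈ range N, max (a.rowLen k) (b.rowLen k) := by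
    rw [← sum_range_succ' (fun k => max (a.rowLen k) (b.rowLen k)), sum_range_succ, h1, h2]
    simp
  have hab : ∑ k ∈ range N, a.rowLen k + ∑ k ∈ range N, b.rowLen k =
      ∑ k ∈ range N, max (a.rowLen k) (b.rowLen k) +
      ∑ k ∈ range N, min (a.rowLen k) (b.rowLen k) := by
    rw [← sum_add_distrib, ← sum_add_distrib]
    refine sum_congr rfl fun k _ => ?_
    omega
  have hlg : ∑ k ∈ range N, l.rowLen (k + 1) + ∑ k ∈ range N, g.rowLen k =
      ∑ k ∈ range N, max (a.rowLen (k + 1)) (b.rowLen (k + 1)) +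
      ∑ k ∈ range N, min (a.rowLen k) (b.rowLen k) := by
    rw [← sum_add_distrib, ← sum_add_distrib]
    refine sum_congr rfl fun k _ => ?_
    have e1 := ha k
    have e2 := hb k
    rw [hl]
    simp only [reflectFun]
    omega
  have h0 : l.rowLen 0 = max (a.rowLen 0) (b.rowLen 0) := hl 0
  omega

theorem exists_incr_top (l : YoungDiagram) :
    ∃ l' : YoungDiagram, (∀ k, l'.rowLen k = l.rowLen k + if k = 0 then 1 else 0) := by
  obtain ⟨N, hN⟩ := exists_rowLen_eq_zero l
  have hanti : Antitone fun k => l.rowLen k + if k = 0 then 1 else 0 := by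
    refine antitone_nat_of_succ_le fun k => ?_
    have := l.rowLen_anti k (k + 1) (Nat.le_succ k)
    simp only [Nat.succ_ne_zero, if_false]
    omega
  have hz : (fun k => l.rowLen k + if k = 0 then 1 else 0) (N + 1) = 0 := by
    simpa using rowLen_eq_zero_of_le hN (show N ≤ N + 1 by omega)
  exact ⟨ofFun _ hanti _ hz, fun k => rowLen_ofFun _ _ _ _ _⟩

theorem exists_decr_top (l : YoungDiagram) (h : l.rowLen 1 < l.rowLen 0) :
    ∃ l' : YoungDiagram, (∀ k, l.rowLen k = l'.rowLen k + if k = 0 then 1 else 0) := by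
  obtain ⟨N, hN⟩ := exists_rowLen_eq_zero l
  have hanti : Antitone fun k => l.rowLen k - if k = 0 then 1 else 0 := by
    refine antitone_nat_of_succ_le fun k => ?_
    have := l.rowLen_anti k (k + 1) (Nat.le_succ k)
    rcases k with _ | k
    · simp only [zero_add, one_ne_zero, if_false, if_true]
      omega
    · simpa using this
  have hz : (fun k => l.rowLen k - if k = 0 then 1 else 0) (N + 1) = 0 := by
    simpa using rowLen_eq_zero_of_le hN (show N ≤ N + 1 by omega)
  refine ⟨ofFun _ hanti _ hz, fun k => ?_⟩
  rw [rowLen_ofFun]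
  rcases k with _ | k
  · simp only [if_true]
    omega
  · simp

theorem card_incr_top {l l' : YoungDiagram}
    (h : ∀ k, l'.rowLen k = l.rowLen k + if k = 0 then 1 else 0) : l'.card = l.card + 1 := by
  obtain ⟨N, hN⟩ := exists_rowLen_eq_zero l
  have h1 := rowLen_eq_zero_of_le hN (show N ≤ N + 1 by omega)
  have h2 : l'.rowLen (N + 1) = 0 := by simp [h, h1]
  rw [card_eq_sum h1, card_eq_sum h2, sum_congr rfl fun k _ => h k, sum_add_distrib]
  simp

theorem HStrip.incr_top {m l l' : YoungDiagram} (hm : HStrip m l)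
    (h : ∀ k, l'.rowLen k = l.rowLen k + if k = 0 then 1 else 0) : HStrip m l' := by
  intro k
  have e := hm k
  rw [h, h]
  simp only [Nat.succ_ne_zero, if_false]
  omega

set_option maxHeartbeats 1600000 in
/-- The local Robinson–Schensted–Knuth rule: commutation of adding and removing horizontal
strips. -/
theorem sum_stripUp_stripDown (φ : YoungDiagram → ℝ) (α : YoungDiagram) (i j : ℕ) :
    ∑ l ∈ stripUp α (i + 1), ∑ ν ∈ stripDown l (j + 1), φ ν =
      ∑ l ∈ stripUp α i, ∑ ν ∈ stripDown l j, φ ν +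
        ∑ μ ∈ stripDown α (j + 1), ∑ ν ∈ stripUp μ (i + 1), φ ν := by
  simp only [sum_sigma']
  rw [← sum_filter_not_add_sum_filter _
    (fun p : Sigma fun _ : YoungDiagram => YoungDiagram =>
      p.1.rowLen 0 = max (α.rowLen 0) (p.2.rowLen 0))]
  congr 1
  · choose T hT using exists_incr_top
    refine (sum_bij (fun p _ => ⟨T p.1, p.2⟩) ?_ ?_ ?_ ?_).symm
    · rintro ⟨l, ν⟩ hp
      simp only [mem_sigma, mem_stripUp, mem_stripDown, mem_filter] at hp ⊢
      have hc := card_incr_top (hT l)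
      refine ⟨⟨⟨hp.1.1.incr_top (hT l), by omega⟩, hp.2.1.incr_top (hT l), by omega⟩, ?_⟩
      have h1 := (hp.1.1 0).1
      have h2 := (hp.2.1 0).1
      have h3 := hT l 0
      simp only [if_true] at h3
      omega
    · rintro ⟨l, ν⟩ - ⟨l', ν'⟩ - h
      obtain ⟨h1, h2⟩ := Sigma.mk.inj_iff.1 h
      have h1' : T l = T l' := h1
      have h2' := eq_of_heq h2
      have : l = l' := by
        apply ext_rowLen
        intro k
        have e1 := hT l k
        have e2 := hT l' k
        rw [h1'] at e1
        omega
      simp only at h2'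
      rw [this, h2']
    · rintro ⟨l, ν⟩ hp
      simp only [mem_sigma, mem_stripUp, mem_stripDown, mem_filter] at hp
      obtain ⟨⟨⟨ha, hc⟩, hb, hd⟩, hne⟩ := hp
      have e1 := ha 0
      have e2 := hb 0
      rw [zero_add] at e1 e2
      obtain ⟨l', hl'⟩ := exists_decr_top l (by omega)
      have hcard := card_incr_top hl'
      have hTl : T l' = l := ext_rowLen fun k => by rw [hT, hl']
      refine ⟨⟨l', ν⟩, ?_, by rw [hTl]⟩
      simp only [mem_sigma, mem_stripUp, mem_stripDown]
      refine ⟨⟨fun k => ?_, by omega⟩, fun k => ?_, by omega⟩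
      · have e3 := ha k
        have e4 := hl' k
        have e5 := hl' (k + 1)
        simp only [Nat.succ_ne_zero, if_false] at e5
        split_ifs at e4 with hk
        · subst hk
          omega
        · omega
      · have e3 := hb k
        have e4 := hl' k
        have e5 := hl' (k + 1)
        simp only [Nat.succ_ne_zero, if_false] at e5
        split_ifs at e4 with hk
        · subst hk
          omega
        · omega
    · intros
      rfl
  · have hex : ∀ p ∈ (stripDown α (j + 1)).sigma fun μ => stripUp μ (i + 1),
        ∃ l : YoungDiagram, ∀ k, l.rowLen k = reflectFun α p.2 p.1 k := by
      rintro ⟨μ, ν⟩ hp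
      simp only [mem_sigma, mem_stripUp, mem_stripDown] at hp
      exact exists_reflect hp.1.1 hp.2.1
    choose L hL using hex
    refine (sum_bij (fun p hp => ⟨L p hp, p.2⟩) ?_ ?_ ?_ ?_).symm
    · rintro ⟨μ, ν⟩ hp
      have hl := hL _ hp
      set l := L _ hp
      simp only [mem_sigma, mem_stripUp, mem_stripDown, mem_filter] at hp hl ⊢
      have hc := card_add_card_reflect hp.1.1 hp.2.1 hl
      refine ⟨⟨⟨fun k => ?_, by omega⟩, fun k => ?_, by omega⟩, hl 0⟩
      all_goals
        have e1 := hp.1.1 k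
        have e2 := hp.2.1 k
        have e5 := hl (k + 1)
        rcases k with _ | k
        · have e4 := hl 0
          simp only [reflectFun] at e4 e5
          omega
        · have e3 := hp.1.1 k
          have e6 := hp.2.1 k
          have e4 := hl (k + 1)
          simp only [reflectFun] at e4 e5
          omega
    · rintro ⟨μ, ν⟩ hp ⟨μ', ν'⟩ hp' h
      obtain ⟨h1, h2⟩ := Sigma.mk.inj_iff.1 h
      have h2' := eq_of_heq h2
      simp only at h2'
      subst h2'
      have hl := hL _ hp
      have hl' := hL _ hp'
      simp only [mem_sigma, mem_stripUp, mem_stripDown] at hp hp' hl hl'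
      have : μ = μ' := by
        apply ext_rowLen
        intro k
        have e1 := hl (k + 1)
        have e2 := hl' (k + 1)
        rw [h1] at e1
        have e3 := hp.1.1 k
        have e4 := hp.2.1 k
        have e5 := hp'.1.1 k
        have e6 := hp'.2.1 k
        simp only [reflectFun] at e1 e2
        omega
      rw [this]
    · rintro ⟨l, ν⟩ hp
      simp only [mem_sigma, mem_stripUp, mem_stripDown, mem_filter] at hp
      obtain ⟨⟨⟨ha, hc⟩, hb, hd⟩, heq⟩ := hp
      obtain ⟨g, hg⟩ := exists_reflectInv ha hb
      have hga : HStrip g α := by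
        intro k
        have e1 := hg k
        have e2 := ha k
        have e3 := hb k
        have e4 := ha (k + 1)
        have e5 := hb (k + 1)
        simp only [reflectInvFun] at e1
        omega
      have hgb : HStrip g ν := by
        intro k
        have e1 := hg k
        have e2 := ha k
        have e3 := hb k
        have e4 := ha (k + 1)
        have e5 := hb (k + 1)
        simp only [reflectInvFun] at e1
        omega
      have hlg : ∀ k, l.rowLen k = reflectFun α ν g k := by
        intro k
        rcases k with _ | k
        · exact heq
        · have e1 := hg k
          have e2 := ha k
          have e3 := hb k
          have e4 := ha (k + 1)
          have e5 := hb (k + 1)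
          simp only [reflectInvFun] at e1
          simp only [reflectFun]
          omega
      have hcard := card_add_card_reflect hga hgb hlg
      have hmem : (⟨g, ν⟩ : Sigma fun _ : YoungDiagram => YoungDiagram) ∈
          (stripDown α (j + 1)).sigma fun μ => stripUp μ (i + 1) := by
        simp only [mem_sigma, mem_stripUp, mem_stripDown]
        exact ⟨⟨hga, by omega⟩, hgb, by omega⟩
      refine ⟨⟨g, ν⟩, hmem, ?_⟩
      have : L _ hmem = l := ext_rowLen fun k => by rw [hL, hlg]
      rw [this]
    · intros
      rfl

theorem stripUp_zero (α : YoungDiagram) : stripUp α 0 = {α} := by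
  ext l
  rw [mem_stripUp, mem_singleton]
  constructor
  · rintro ⟨h, hc⟩
    exact (eq_of_le_of_card_le h.le (by omega)).symm
  · rintro rfl
    exact ⟨HStrip.refl _, rfl⟩

theorem stripDown_zero (α : YoungDiagram) : stripDown α 0 = {α} := by
  ext l
  rw [mem_stripDown, mem_singleton]
  constructor
  · rintro ⟨h, hc⟩
    exact eq_of_le_of_card_le h.le (by omega)
  · rintro rfl
    exact ⟨HStrip.refl _, rfl⟩

theorem card_stripUp_succ (α : YoungDiagram) (i : ℕ) :
    (stripUp α (i + 1)).card = (stripUp α i).card + (stripDown α (i + 1)).card := by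
  classical
  have h := sum_stripUp_stripDown (fun ν => if ν = α then 1 else 0) α i i
  have h1 : ∀ k, ∀ l ∈ stripUp α k,
      (∑ ν ∈ stripDown l k, if ν = α then (1 : ℝ) else 0) = 1 := by
    intro k l hl
    rw [mem_stripUp] at hl
    rw [sum_ite_eq', if_pos (mem_stripDown.2 ⟨hl.1, by omega⟩)]
  have h2 : ∀ μ ∈ stripDown α (i + 1),
      (∑ ν ∈ stripUp μ (i + 1), if ν = α then (1 : ℝ) else 0) = 1 := by
    intro μ hμ
    rw [mem_stripDown] at hμ
    rw [sum_ite_eq', if_pos (mem_stripUp.2 ⟨hμ.1, by omega⟩)]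
  rw [sum_congr rfl (h1 (i + 1)), sum_congr rfl (h1 i), sum_congr rfl h2] at h
  simp only [sum_const, nsmul_eq_mul, mul_one] at h
  exact_mod_cast h

theorem mem_skewSYT {m l : YoungDiagram} {n : ℕ} {c : Fin (n + 1) → YoungDiagram} :
    c ∈ skewSYT m l n ↔ c 0 = m ∧ c (Fin.last n) = l ∧ IsSYTChain c := by
  classical
  rw [skewSYT, mem_filter, and_iff_right_iff_imp, Fintype.mem_piFinset]
  rintro ⟨-, rfl, hc⟩ a
  rw [mem_subDiagrams]
  have hmono : Monotone c := Fin.monotone_iff_le_succ.2 fun i => (hc i i.2).1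
  exact hmono (Fin.le_last a)

/-- The row of the cell in which two consecutive diagrams differ. -/
def stepRow (m l : YoungDiagram) : ℕ := (l.cells \ m.cells).sup Prod.fst

theorem rowLen_of_step {m l : YoungDiagram} (h : m ≤ l) (hc : l.card = m.card + 1) (k : ℕ) :
    l.rowLen k = m.rowLen k + if k = stepRow m l then 1 else 0 := by
  have hcard : (l.cells \ m.cells).card = 1 := by
    rw [card_sdiff_of_subset (YoungDiagram.cells_subset_iff.2 h)]
    change l.card - m.card = 1
    omega
  obtain ⟨⟨r, c⟩, hrc⟩ := card_eq_one.1 hcard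
  have hr : stepRow m l = r := by rw [stepRow, hrc, sup_singleton]
  have hmem : ∀ x : ℕ × ℕ, x ∈ l ↔ x ∈ m ∨ x = (r, c) := by
    intro x
    have h1 : x ∈ l.cells \ m.cells ↔ x = (r, c) := by rw [hrc, mem_singleton]
    rw [mem_sdiff, YoungDiagram.mem_cells, YoungDiagram.mem_cells] at h1
    have h2 := @h x
    tauto
  have hnot : (r, c) ∉ m := by
    have h1 : (r, c) ∈ l.cells \ m.cells := by rw [hrc, mem_singleton]
    rw [mem_sdiff, YoungDiagram.mem_cells, YoungDiagram.mem_cells] at h1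
    exact h1.2
  have hlt : ∀ k j, j < l.rowLen k ↔ j < m.rowLen k ∨ (k = r ∧ j = c) := by
    intro k j
    rw [← YoungDiagram.mem_iff_lt_rowLen, ← YoungDiagram.mem_iff_lt_rowLen, hmem, Prod.mk.injEq]
  rw [YoungDiagram.mem_iff_lt_rowLen] at hnot
  rw [hr]
  split_ifs with hk
  · subst hk
    have h1 := (hlt k c).2 (Or.inr ⟨rfl, rfl⟩)
    have h2 : c = m.rowLen k := by
      by_contra hne
      have h3 := (hlt k (m.rowLen k)).1 (by omega)
      omega
    have h4 := (hlt k (c + 1)).not.2 (by omega)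
    omega
  · have h1 := hlt k (l.rowLen k)
    have h2 := hlt k (m.rowLen k)
    omega

theorem stepRow_eq {m l : YoungDiagram} {r : ℕ}
    (h : ∀ k, l.rowLen k = m.rowLen k + if k = r then 1 else 0) :
    m ≤ l ∧ l.card = m.card + 1 ∧ stepRow m l = r := by
  have hle : m ≤ l := le_iff_rowLen.2 fun k => by rw [h]; omega
  have hc : l.card = m.card + 1 := by
    obtain ⟨N, hN⟩ := exists_rowLen_eq_zero m
    have h1 := rowLen_eq_zero_of_le hN (show N ≤ N + r + 1 by omega)
    have h2 : l.rowLen (N + r + 1) = 0 := by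
      rw [h, h1, if_neg (by omega)]
    rw [card_eq_sum h1, card_eq_sum h2, sum_congr rfl fun k _ => h k, sum_add_distrib,
      sum_ite_eq', if_pos (mem_range.2 (by omega))]
  refine ⟨hle, hc, ?_⟩
  by_contra hne
  have h1 := rowLen_of_step hle hc r
  rw [h, if_pos rfl, if_neg (Ne.symm hne)] at h1
  omega

/-- `d` adds one cell at a time between the indices `a` and `b`. -/
def ChainOn (d : ℕ → YoungDiagram) (a b : ℕ) : Prop :=
  ∀ i, a ≤ i → i < b → d i ≤ d (i + 1) ∧ (d (i + 1)).card = (d i).card + 1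

/-- `d` has no descent between the indices `a` and `b`. -/
def NoDescOn (d : ℕ → YoungDiagram) (a b : ℕ) : Prop :=
  ∀ i, a ≤ i → i + 1 < b → ¬ stepRow (d i) (d (i + 1)) < stepRow (d (i + 1)) (d (i + 1 + 1))

theorem ChainOn.le {d : ℕ → YoungDiagram} {a b : ℕ} (h : ChainOn d a b) (hab : a ≤ b) :
    d a ≤ d b ∧ (d b).card = (d a).card + (b - a) := by
  induction b, hab using Nat.le_induction with
  | base => simp
  | succ b hab ih =>
    have h1 := ih fun i hi hib => h i hi (by omega)
    have h2 := h b hab (by omega)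
    exact ⟨h1.1.trans h2.1, by omega⟩

theorem hstrip_of_noDescOn {d : ℕ → YoungDiagram} {a b : ℕ} (hab : a ≤ b)
    (h : ChainOn d a b) (hn : NoDescOn d a b) :
    HStrip (d a) (d b) ∧
      (a < b → ∀ k < stepRow (d (b - 1)) (d b), (d b).rowLen k = (d a).rowLen k) := by
  induction b, hab using Nat.le_induction with
  | base => exact ⟨HStrip.refl _, fun h => absurd h (lt_irrefl _)⟩
  | succ b hab ih =>
    obtain ⟨h1, h2⟩ := ih (fun i hi hib => h i hi (by omega)) fun i hi hib => hn i hi (by omega)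
    have h3 := h b hab (by omega)
    have h4 := rowLen_of_step h3.1 h3.2
    have h5 : ∀ k < stepRow (d b) (d (b + 1)), (d b).rowLen k = (d a).rowLen k := by
      intro k hk
      rcases hab.eq_or_lt with rfl | hlt
      · rfl
      · refine h2 hlt k (hk.trans_le ?_)
        have := hn (b - 1) (by omega) (by omega)
        rw [Nat.sub_add_cancel (by omega)] at this
        exact not_lt.1 this
    have h6 : ∀ k < stepRow (d b) (d (b + 1)), (d (b + 1)).rowLen k = (d a).rowLen k := by
      intro k hk
      rw [h4, if_neg (by omega), h5 k hk, add_zero]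
    refine ⟨fun k => ?_, fun _ => by simpa using h6⟩
    have h7 := h1 k
    have h8 := h4 k
    have h9 := h4 (k + 1)
    refine ⟨by omega, ?_⟩
    split_ifs at h9 with hk
    · have h10 := h5 k (by omega)
      have := (d (b + 1)).rowLen_anti k (k + 1) (Nat.le_succ k)
      rw [if_neg (by omega)] at h8
      omega
    · omega

theorem stepRow_lt_of_noDescOn {d : ℕ → YoungDiagram} {a b : ℕ} (hab : a ≤ b)
    (h : ChainOn d a (b + 1)) :
    (d a).rowLen (stepRow (d b) (d (b + 1))) < (d (b + 1)).rowLen (stepRow (d b) (d (b + 1))) := by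
  have h1 : ChainOn d a b := fun i hi hib => h i hi (by omega)
  have h2 := le_iff_rowLen.1 (h1.le hab).1 (stepRow (d b) (d (b + 1)))
  have h3 := h b hab (by omega)
  have h4 := rowLen_of_step h3.1 h3.2 (stepRow (d b) (d (b + 1)))
  rw [if_pos rfl] at h4
  omega

theorem eq_of_noDescOn {d e : ℕ → YoungDiagram} {a b : ℕ} (hab : a ≤ b)
    (hd : ChainOn d a b) (he : ChainOn e a b) (hnd : NoDescOn d a b) (hne : NoDescOn e a b)
    (ha : d a = e a) (hb : d b = e b) : ∀ i, a ≤ i → i ≤ b → d i = e i := by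
  induction b, hab using Nat.le_induction with
  | base =>
    intro i h1 h2
    rw [le_antisymm h2 h1, ha]
  | succ b hab ih =>
    have hs : ∀ {d e : ℕ → YoungDiagram}, ChainOn d a (b + 1) → ChainOn e a (b + 1) →
        NoDescOn e a (b + 1) → d a = e a → d (b + 1) = e (b + 1) →
        stepRow (e b) (e (b + 1)) ≤ stepRow (d b) (d (b + 1)) := by
      intro d e hd he hne ha hb
      by_contra! hlt
      have h1 := (hstrip_of_noDescOn (by omega) he hne).2 (by omega) _ (by simpa using hlt)
      have h2 := stepRow_lt_of_noDescOn hab hd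
      rw [ha, hb] at h2
      rw [hb] at h1
      omega
    have hr : stepRow (d b) (d (b + 1)) = stepRow (e b) (e (b + 1)) :=
      le_antisymm (hs he hd hnd ha.symm hb.symm) (hs hd he hne ha hb)
    have hdb : d b = e b := by
      apply ext_rowLen
      intro k
      have h1 := hd b hab (by omega)
      have h2 := rowLen_of_step h1.1 h1.2 k
      have h3 := he b hab (by omega)
      have h4 := rowLen_of_step h3.1 h3.2 k
      rw [hr, hb] at h2
      omega
    intro i h1 h2
    rcases h2.eq_or_lt with rfl | hlt
    · exact hb
    · exact ih (fun i hi hib => hd i hi (by omega)) (fun i hi hib => he i hi (by omega))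
        (fun i hi hib => hnd i hi (by omega)) (fun i hi hib => hne i hi (by omega)) hdb i h1
        (by omega)

theorem exists_noDescOn (i : ℕ) {m l : YoungDiagram} (h : HStrip m l)
    (hc : l.card = m.card + i) :
    ∃ d : ℕ → YoungDiagram, d 0 = m ∧ d i = l ∧ ChainOn d 0 i ∧ NoDescOn d 0 i := by
  induction i generalizing l with
  | zero =>
    have := eq_of_le_of_card_le h.le (by omega)
    exact ⟨fun _ => m, rfl, this, fun i _ h => absurd h (by omega), fun i _ h => absurd h (by omega)⟩
  | succ i ih =>
    have hex : ∃ r, m.rowLen r < l.rowLen r := by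
      by_contra! hle
      have := card_mono (le_iff_rowLen.2 hle)
      omega
    classical
    have hr := Nat.find_spec hex
    have hmin : ∀ k, m.rowLen k < l.rowLen k → Nat.find hex ≤ k := fun k hk => Nat.find_min' hex hk
    generalize Nat.find hex = r at hr hmin
    have hanti : Antitone fun k => l.rowLen k - if k = r then 1 else 0 := by
      refine antitone_nat_of_succ_le fun k => ?_
      have h1 := l.rowLen_anti k (k + 1) (Nat.le_succ k)
      have h2 := h k
      split_ifs <;> subst_vars <;> omega
    obtain ⟨N, hN⟩ := exists_rowLen_eq_zero l
    have hz : (fun k => l.rowLen k - if k = r then 1 else 0) N = 0 := by simp [hN]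
    obtain ⟨l', hl'⟩ : ∃ l' : YoungDiagram,
        ∀ k, l'.rowLen k = l.rowLen k - if k = r then 1 else 0 :=
      ⟨ofFun _ hanti _ hz, fun k => rowLen_ofFun _ _ _ _ _⟩
    have hl : ∀ k, l.rowLen k = l'.rowLen k + if k = r then 1 else 0 := by
      intro k
      have := hl' k
      split_ifs at this ⊢ <;> subst_vars <;> omega
    obtain ⟨hle, hcard, hrow⟩ := stepRow_eq hl
    have hstrip : HStrip m l' := by
      intro k
      have h1 := h k
      have h2 := hl k
      have h3 := hl (k + 1)
      split_ifs at h2 h3 <;> subst_vars <;> omega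
    obtain ⟨d, hd0, hdi, hdc, hdn⟩ := ih hstrip (by omega)
    refine ⟨fun j => if j ≤ i then d j else l, by simpa using hd0, by simp, ?_, ?_⟩
    · intro j h1 h2
      simp only
      rw [if_pos (by omega)]
      split_ifs with h3
      · exact hdc j h1 h3
      · obtain rfl : j = i := by omega
        rw [hdi]
        exact ⟨hle, hcard⟩
    · intro j h1 h2
      simp only
      rw [if_pos (by omega), if_pos (by omega)]
      split_ifs with h3
      · exact hdn j h1 h3
      · obtain rfl : i = j + 1 := by omega
        rw [hdi, hrow, not_lt]
        apply hmin
        have := stepRow_lt_of_noDescOn (Nat.zero_le j) hdc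
        rw [hd0, hdi] at this
        exact this.trans_le (le_iff_rowLen.1 hle _)

open scoped Classical in
/-- The sum of `i + 1` over the `i` with `i + 1 < n` satisfying `D`. -/
noncomputable def descSum (D : ℕ → Prop) (n : ℕ) : ℕ :=
  ∑ i ∈ range n, if i + 1 < n ∧ D i then i + 1 else 0

theorem descSum_zero (D : ℕ → Prop) : descSum D 0 = 0 := by simp [descSum]

theorem descSum_one (D : ℕ → Prop) : descSum D 1 = 0 := by simp [descSum]

open scoped Classical in
theorem descSum_succ_succ (D : ℕ → Prop) (n : ℕ) :
    descSum D (n + 2) = descSum D (n + 1) + if D n then n + 1 else 0 := by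
  unfold descSum
  rw [sum_range_succ, sum_range_succ, sum_range_succ, if_neg (by omega : ¬ (n + 1 + 1 < n + 2 ∧ _)),
    if_neg (by omega : ¬ (n + 1 < n + 1 ∧ _)), add_zero, add_zero]
  congr 1
  · refine sum_congr rfl fun i hi => ?_
    rw [mem_range] at hi
    simp only [show i + 1 < n + 2 by omega, show i + 1 < n + 1 by omega]
  · simp

theorem descSum_congr {D D' : ℕ → Prop} {n : ℕ} (h : ∀ i, i + 1 < n → (D i ↔ D' i)) :
    descSum D n = descSum D' n := by
  unfold descSum
  refine sum_congr rfl fun i _ => ?_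
  by_cases hi : i + 1 < n
  · have h1 := h i hi
    by_cases hD : D i
    · rw [if_pos ⟨hi, hD⟩, if_pos ⟨hi, h1.1 hD⟩]
    · rw [if_neg fun h => hD h.2, if_neg fun h => hD (h1.2 h.2)]
  · rw [if_neg fun h => hi h.1, if_neg fun h => hi h.1]

/-- The product `(1 - q) (1 - q ^ 2) ⋯ (1 - q ^ n)`. -/
noncomputable def poch (q : ℝ) (n : ℕ) : ℝ := ∏ i ∈ range n, (1 - q ^ (i + 1))

theorem poch_zero (q : ℝ) : poch q 0 = 1 := by simp [poch]

theorem poch_succ (q : ℝ) (n : ℕ) : poch q (n + 1) = poch q n * (1 - q ^ (n + 1)) := by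
  rw [poch, prod_range_succ, poch]

theorem one_sub_pow_ne_zero {q : ℝ} (h1 : q ≠ 1) (h2 : q ≠ -1) (n : ℕ) : 1 - q ^ (n + 1) ≠ 0 := by
  intro h
  have h3 : q ^ (n + 1) = 1 := by linarith
  rcases pow_eq_one_iff_cases.1 h3 with h | h | h
  · omega
  · exact h1 h
  · exact h2 h.1

theorem poch_ne_zero {q : ℝ} (h1 : q ≠ 1) (h2 : q ≠ -1) (n : ℕ) : poch q n ≠ 0 :=
  prod_ne_zero_iff.2 fun i _ => one_sub_pow_ne_zero h1 h2 i

open scoped Classical in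
theorem pow_descSum_div_poch {q : ℝ} (h1 : q ≠ 1) (h2 : q ≠ -1) (D : ℕ → Prop) (n : ℕ) :
    q ^ descSum D n / poch q n = ∑ i ∈ range (n + 1),
      if ∀ j, n - i ≤ j → j + 1 < n → ¬ D j then
        q ^ (n - i) * (q ^ descSum D (n - i) / poch q (n - i)) else 0 := by
  induction n with
  | zero => simp [descSum_zero, poch_zero]
  | succ n ih =>
    rw [sum_range_succ', if_pos (by intro j _ _; omega), Nat.sub_zero]
    have hp := poch_ne_zero h1 h2 n
    have hp1 := poch_ne_zero h1 h2 (n + 1)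
    have ho := one_sub_pow_ne_zero h1 h2 n
    have key : ∑ k ∈ range (n + 1), (if ∀ j, n + 1 - (k + 1) ≤ j → j + 1 < n + 1 → ¬ D j then
        q ^ (n + 1 - (k + 1)) * (q ^ descSum D (n + 1 - (k + 1)) / poch q (n + 1 - (k + 1))) else 0)
        = q ^ descSum D (n + 1) / poch q n := by
      simp only [Nat.add_sub_add_right]
      rcases n with _ | m
      · simp [descSum_one, descSum_zero]
      rw [descSum_succ_succ]
      by_cases hD : D m
      · rw [if_pos hD, sum_range_succ', sum_eq_zero, Nat.sub_zero, if_pos (by intro j _ _; omega)]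
        · rw [pow_add]; ring
        · intro k hk
          rw [if_neg]
          intro h
          exact h m (by omega) (by omega) hD
      · rw [if_neg hD, add_zero, ih]
        refine sum_congr rfl fun k _ => ?_
        congr 1
        refine propext ⟨fun h j hj hj2 => h j hj (by omega), fun h j hj hj2 => ?_⟩
        by_cases hjm : j = m
        · exact hjm ▸ hD
        · exact h j hj (by omega)
    rw [key, poch_succ]
    field_simp
    ring

/-- The extension of a finite chain to a sequence which is eventually constant. -/
def extendChain {n : ℕ} (c : Fin (n + 1) → YoungDiagram) (j : ℕ) : YoungDiagram :=
  c ⟨min j n, by omega⟩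

/-- The sequence `d` of diagrams has a descent at the index `i`. -/
def StepDesc (d : ℕ → YoungDiagram) (i : ℕ) : Prop :=
  stepRow (d i) (d (i + 1)) < stepRow (d (i + 1)) (d (i + 1 + 1))

theorem extendChain_of_le {n : ℕ} (c : Fin (n + 1) → YoungDiagram) {j : ℕ} (h : j ≤ n) :
    extendChain c j = c ⟨j, by omega⟩ := by
  simp only [extendChain, min_eq_left h]

theorem extendChain_restrict (d : ℕ → YoungDiagram) {n j : ℕ} (h : j ≤ n) :
    extendChain (fun k : Fin (n + 1) => d k) j = d j := by
  simp only [extendChain, min_eq_left h]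

theorem isSYTChain_iff {n : ℕ} {c : Fin (n + 1) → YoungDiagram} :
    IsSYTChain c ↔ ChainOn (extendChain c) 0 n := by
  constructor
  · intro h i _ hi
    rw [extendChain_of_le c hi.le, extendChain_of_le c hi]
    exact h i hi
  · intro h i hi
    have := h i (Nat.zero_le _) hi
    rwa [extendChain_of_le c hi.le, extendChain_of_le c hi] at this

theorem mem_skewSYT_iff {m l : YoungDiagram} {n : ℕ} {c : Fin (n + 1) → YoungDiagram} :
    c ∈ skewSYT m l n ↔
      extendChain c 0 = m ∧ extendChain c n = l ∧ ChainOn (extendChain c) 0 n := by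
  rw [mem_skewSYT, isSYTChain_iff, extendChain_of_le c le_rfl, extendChain_of_le c (Nat.zero_le n)]
  rfl

theorem chainMaj_eq {n : ℕ} (c : Fin (n + 1) → YoungDiagram) :
    chainMaj c = descSum (StepDesc (extendChain c)) n := by
  unfold chainMaj descSum
  refine sum_congr rfl fun i _ => ?_
  have key : i + 1 < n → (rowOfStep c i < rowOfStep c (i + 1) ↔ StepDesc (extendChain c) i) := by
    intro hi
    rw [rowOfStep, rowOfStep, dif_pos (by omega), dif_pos hi, StepDesc, extendChain_of_le c hi.le,
      extendChain_of_le c hi, extendChain_of_le c (show i ≤ n by omega)]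
    rfl
  by_cases hi : i + 1 < n
  · have h1 := key hi
    by_cases hD : StepDesc (extendChain c) i
    · rw [if_pos ⟨hi, h1.2 hD⟩, if_pos ⟨hi, hD⟩]
    · rw [if_neg fun h => hD (h1.1 h.2), if_neg fun h => hD h.2]
  · rw [if_neg fun h => hi h.1, if_neg fun h => hi h.1]

theorem stepDesc_congr {d e : ℕ → YoungDiagram} {i : ℕ} (h0 : d i = e i)
    (h1 : d (i + 1) = e (i + 1)) (h2 : d (i + 1 + 1) = e (i + 1 + 1)) :
    StepDesc d i ↔ StepDesc e i := by
  rw [StepDesc, StepDesc, h0, h1, h2]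

open scoped Classical in
theorem sum_noDescOn (α l : YoungDiagram) (m i : ℕ) (q : ℝ) :
    ∑ c ∈ (skewSYT α l (m + i)).filter (fun c => NoDescOn (extendChain c) m (m + i)),
      q ^ descSum (StepDesc (extendChain c)) m = ∑ β ∈ stripDown l i, fSkew α β m q := by
  unfold fSkew
  rw [sum_sigma']
  refine sum_bij (fun c _ => (⟨extendChain c m, fun k => extendChain c k⟩ :
    Σ _ : YoungDiagram, Fin (m + 1) → YoungDiagram)) ?_ ?_ ?_ ?_
  · intro c hc
    rw [mem_filter, mem_skewSYT_iff] at hc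
    obtain ⟨⟨h1, h2, h3⟩, h4⟩ := hc
    have hch : ChainOn (extendChain c) m (m + i) := fun k hk hk2 => h3 k (Nat.zero_le _) hk2
    rw [mem_sigma, mem_stripDown, mem_skewSYT_iff, extendChain_restrict _ (Nat.zero_le _),
      extendChain_restrict _ le_rfl]
    refine ⟨?_, h1, rfl, ?_⟩
    · have h5 := (hstrip_of_noDescOn (Nat.le_add_right m i) hch h4).1
      have h6 := (hch.le (Nat.le_add_right m i)).2
      rw [h2] at h5 h6
      exact ⟨h5, by dsimp only; omega⟩
    · intro k hk hk2
      rw [extendChain_restrict _ hk2.le, extendChain_restrict _ hk2]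
      exact h3 k hk (by omega)
  · intro c hc c' hc' heq
    rw [mem_filter, mem_skewSYT_iff] at hc hc'
    obtain ⟨⟨h1, h2, h3⟩, h4⟩ := hc
    obtain ⟨⟨h1', h2', h3'⟩, h4'⟩ := hc'
    rw [Sigma.mk.injEq] at heq
    have h5 := eq_of_noDescOn (Nat.le_add_right m i) (fun k _ hk2 => h3 k (Nat.zero_le _) hk2)
      (fun k _ hk2 => h3' k (Nat.zero_le _) hk2) h4 h4' heq.1 (h2.trans h2'.symm)
    have h6 := eq_of_heq heq.2
    funext ⟨k, hk⟩
    have h7 : extendChain c k = extendChain c' k := by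
      by_cases hkm : k ≤ m
      · exact congrFun h6 ⟨k, by omega⟩
      · exact h5 k (by omega) (by omega)
    rwa [extendChain_of_le _ (by omega), extendChain_of_le _ (by omega)] at h7
  · rintro ⟨β, c'⟩ hb
    rw [mem_sigma, mem_stripDown, mem_skewSYT_iff] at hb
    obtain ⟨⟨h1, h2⟩, h3, h4, h5⟩ := hb
    dsimp only at h1 h2 h3 h4 h5
    obtain ⟨d, hd0, hdi, hd1, hd2⟩ := exists_noDescOn i h1 h2.symm
    have hA : ∀ k, k ≤ m → (if k ≤ m then extendChain c' k else d (k - m)) = extendChain c' k :=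
      fun k hk => if_pos hk
    have hB : ∀ k, m ≤ k → (if k ≤ m then extendChain c' k else d (k - m)) = d (k - m) := by
      intro k hk
      split_ifs with h
      · obtain rfl : k = m := by omega
        rw [h4, Nat.sub_self, hd0]
      · rfl
    generalize hg : (fun k => if k ≤ m then extendChain c' k else d (k - m)) = g
    have hA : ∀ k, k ≤ m → g k = extendChain c' k := by rw [← hg]; exact hA
    have hB : ∀ k, m ≤ k → g k = d (k - m) := by rw [← hg]; exact hB
    have hE : ∀ k, k ≤ m + i → extendChain (fun k : Fin (m + i + 1) => g k) k = g k :=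
      fun k hk => extendChain_restrict g hk
    have hE2 : ∀ k, k ≤ m → extendChain (fun k : Fin (m + i + 1) => g k) k = extendChain c' k :=
      fun k hk => by rw [hE k (by omega), hA k hk]
    refine ⟨fun k => g k, ?_, ?_⟩
    · rw [mem_filter, mem_skewSYT_iff]
      refine ⟨⟨?_, ?_, ?_⟩, ?_⟩
      · rw [hE2 0 (by omega), h3]
      · rw [hE _ le_rfl, hB _ (by omega), Nat.add_sub_cancel_left, hdi]
      · intro k _ hk
        rw [hE _ hk, hE _ hk.le]
        by_cases hkm : k < m
        · rw [hA _ hkm.le, hA _ hkm]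
          exact h5 k (Nat.zero_le _) hkm
        · rw [hB k (by omega), hB (k + 1) (by omega), show k + 1 - m = k - m + 1 by omega]
          exact hd1 _ (Nat.zero_le _) (by omega)
      · intro k hk hk2
        rw [hE _ hk2, hE k (by omega), hE (k + 1) hk2.le, hB k hk, hB (k + 1) (by omega),
          hB (k + 1 + 1) (by omega), show k + 1 - m = k - m + 1 by omega,
          show k + 1 + 1 - m = k - m + 1 + 1 by omega]
        exact hd2 _ (Nat.zero_le _) (by omega)
    · refine Sigma.ext ?_ (heq_of_eq ?_)
      · exact (hE2 m le_rfl).trans h4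
      · funext ⟨k, hk⟩
        dsimp only
        rw [hE2 k (by omega), extendChain_of_le c' (by omega)]
  · intro c hc
    dsimp only
    rw [chainMaj_eq]
    congr 1
    refine descSum_congr fun k hk => stepDesc_congr ?_ ?_ ?_
    all_goals rw [extendChain_restrict _ (by omega)]

/-- The `q`-count of skew tableaux, normalised by `poch`. -/
noncomputable def skewNorm (q : ℝ) (n : ℕ) (m l : YoungDiagram) : ℝ := fSkew m l n q / poch q n

theorem skewNorm_rec {q : ℝ} (h1 : q ≠ 1) (h2 : q ≠ -1) (n : ℕ) (α l : YoungDiagram) :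
    skewNorm q n α l = ∑ i ∈ range (n + 1),
      q ^ (n - i) * ∑ β ∈ stripDown l i, skewNorm q (n - i) α β := by
  classical
  have hL : skewNorm q n α l = ∑ c ∈ skewSYT α l n, q ^ descSum (StepDesc (extendChain c)) n
      / poch q n := by
    rw [skewNorm, fSkew, sum_div]
    exact sum_congr rfl fun c _ => by rw [chainMaj_eq]
  rw [hL, sum_congr rfl fun c _ => pow_descSum_div_poch h1 h2 _ n, sum_comm]
  refine sum_congr rfl fun i hi => ?_
  rw [mem_range] at hi
  obtain ⟨m, rfl⟩ : ∃ m, n = m + i := ⟨n - i, by omega⟩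
  rw [Nat.add_sub_cancel, ← sum_filter, ← mul_sum, ← sum_div]
  simp only [skewNorm]
  rw [← sum_div, ← sum_noDescOn α l m i q]
  rfl

theorem skewNorm_zero (q : ℝ) (α l : YoungDiagram) [Decidable (α = l)] :
    skewNorm q 0 α l = if α = l then 1 else 0 := by
  rw [skewNorm, poch_zero, div_one, fSkew]
  split_ifs with h
  · subst h
    rw [sum_eq_single (fun _ => α)]
    · rw [chainMaj_eq, descSum_zero, pow_zero]
    · intro c hc hne
      rw [mem_skewSYT] at hc
      refine absurd (funext fun k => ?_) hne
      rw [Fin.fin_one_eq_zero k, hc.1]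
    · intro h
      refine absurd ?_ h
      rw [mem_skewSYT]
      exact ⟨rfl, rfl, fun i hi => absurd hi (Nat.not_lt_zero _)⟩
  · refine sum_eq_zero fun c hc => ?_
    rw [mem_skewSYT] at hc
    exact absurd (hc.1.symm.trans hc.2.1) h

theorem fSkew_eq_zero (q : ℝ) (n : ℕ) {α l : YoungDiagram}
    (h : ¬ (α ≤ l ∧ l.card = α.card + n)) : fSkew α l n q = 0 := by
  refine sum_eq_zero fun c hc => ?_
  rw [mem_skewSYT_iff] at hc
  obtain ⟨h1, h2, h3⟩ := hc
  have := h3.le (Nat.zero_le n)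
  rw [h1, h2, Nat.sub_zero] at this
  exact absurd this h

theorem skewNorm_eq_zero (q : ℝ) (n : ℕ) {α l : YoungDiagram}
    (h : ¬ (α ≤ l ∧ l.card = α.card + n)) : skewNorm q n α l = 0 := by
  rw [skewNorm, fSkew_eq_zero q n h, zero_div]

/-- The operator of adding a horizontal strip of size `i`. -/
noncomputable def upOp (i : ℕ) : (YoungDiagram → ℝ) →ₗ[ℝ] (YoungDiagram → ℝ) where
  toFun φ α := ∑ l ∈ stripUp α i, φ l
  map_add' _ _ := funext fun _ => sum_add_distrib
  map_smul' _ _ := funext fun _ => (mul_sum _ _ _).symm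

/-- The operator of removing a horizontal strip of size `j`. -/
noncomputable def downOp (j : ℕ) : (YoungDiagram → ℝ) →ₗ[ℝ] (YoungDiagram → ℝ) where
  toFun φ α := ∑ l ∈ stripDown α j, φ l
  map_add' _ _ := funext fun _ => sum_add_distrib
  map_smul' _ _ := funext fun _ => (mul_sum _ _ _).symm

/-- The operator of adding `n` cells, weighted by `skewNorm`. -/
noncomputable def skewOp (q : ℝ) (n : ℕ) : (YoungDiagram → ℝ) →ₗ[ℝ] (YoungDiagram → ℝ) where
  toFun φ α := ∑ l ∈ diagramsOfCard (α.card + n), skewNorm q n α l * φ l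
  map_add' φ ψ := funext fun α => by simp [mul_add, sum_add_distrib]
  map_smul' c φ := funext fun α => by
    simp only [Pi.smul_apply, smul_eq_mul, mul_sum, RingHom.id_apply]
    exact sum_congr rfl fun l _ => by ring

theorem upOp_zero (φ : YoungDiagram → ℝ) : upOp 0 φ = φ := by
  funext α
  change ∑ l ∈ stripUp α 0, φ l = _
  rw [stripUp_zero, sum_singleton]

theorem downOp_zero (φ : YoungDiagram → ℝ) : downOp 0 φ = φ := by
  funext α
  change ∑ l ∈ stripDown α 0, φ l = _
  rw [stripDown_zero, sum_singleton]

theorem skewOp_zero (q : ℝ) (φ : YoungDiagram → ℝ) : skewOp q 0 φ = φ := by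
  classical
  funext α
  change ∑ l ∈ diagramsOfCard (α.card + 0), skewNorm q 0 α l * φ l = _
  simp only [skewNorm_zero, ite_mul, one_mul, zero_mul]
  rw [sum_ite_eq, if_pos]
  exact mem_diagramsOfCard.2 rfl

theorem upOp_downOp (i j : ℕ) (φ : YoungDiagram → ℝ) :
    upOp (i + 1) (downOp (j + 1) φ) = upOp i (downOp j φ) + downOp (j + 1) (upOp (i + 1) φ) :=
  funext fun α => sum_stripUp_stripDown φ α i j

theorem upOp_one (i : ℕ) : upOp (i + 1) 1 = upOp i 1 + downOp (i + 1) 1 := by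
  funext α
  have h : ∀ s : Finset YoungDiagram, ∑ l ∈ s, (1 : YoungDiagram → ℝ) l = s.card := fun s => by simp
  change ∑ l ∈ stripUp α (i + 1), (1 : YoungDiagram → ℝ) l =
    ∑ l ∈ stripUp α i, (1 : YoungDiagram → ℝ) l + ∑ l ∈ stripDown α (i + 1), (1 : YoungDiagram → ℝ) l
  rw [h, h, h, card_stripUp_succ, Nat.cast_add]

theorem skewOp_rec {q : ℝ} (h1 : q ≠ 1) (h2 : q ≠ -1) (n : ℕ) (φ : YoungDiagram → ℝ) :
    skewOp q n φ = ∑ i ∈ range (n + 1), q ^ (n - i) • skewOp q (n - i) (upOp i φ) := by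
  funext α
  rw [Finset.sum_apply]
  change ∑ l ∈ diagramsOfCard (α.card + n), skewNorm q n α l * φ l =
    ∑ i ∈ range (n + 1), q ^ (n - i) * ∑ β ∈ diagramsOfCard (α.card + (n - i)),
      skewNorm q (n - i) α β * ∑ l ∈ stripUp β i, φ l
  simp_rw [skewNorm_rec h1 h2 n α, sum_mul]
  rw [sum_comm]
  refine sum_congr rfl fun i hi => ?_
  rw [mem_range] at hi
  simp_rw [mul_assoc, sum_mul]
  rw [← mul_sum]
  congr 1
  simp_rw [mul_sum]
  refine sum_comm' fun l β => ?_
  rw [mem_diagramsOfCard, mem_diagramsOfCard, mem_stripUp, mem_stripDown]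
  constructor <;> rintro h <;> simp only [h, true_and, and_true] <;> omega

/-- The expansion of `skewOp q n (downOp j φ)` in terms of `downOp` after `skewOp`. -/
noncomputable def commOp (q : ℝ) (n j : ℕ) (φ : YoungDiagram → ℝ) : YoungDiagram → ℝ :=
  ∑ r ∈ range (n + 1), if r ≤ j then (poch q r)⁻¹ • downOp (j - r) (skewOp q (n - r) φ) else 0

theorem inv_poch_succ {q : ℝ} (h1 : q ≠ 1) (h2 : q ≠ -1) (r : ℕ) :
    (poch q (r + 1))⁻¹ = (poch q r)⁻¹ + q ^ (r + 1) * (poch q (r + 1))⁻¹ := by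
  have hp := poch_ne_zero h1 h2 r
  have ho := one_sub_pow_ne_zero h1 h2 r
  rw [poch_succ]
  field_simp
  ring

theorem commOp_succ {q : ℝ} (h1 : q ≠ 1) (h2 : q ≠ -1) (n j : ℕ) (φ : YoungDiagram → ℝ) :
    commOp q (n + 1) (j + 1) φ = commOp q n j φ +
      ∑ i ∈ range (n + 1 + 1), q ^ (n + 1 - i) • commOp q (n + 1 - i) (j + 1) (upOp i φ) := by
  have hsw : ∑ i ∈ range (n + 1 + 1), q ^ (n + 1 - i) • commOp q (n + 1 - i) (j + 1) (upOp i φ) =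
      ∑ r ∈ range (n + 1 + 1), if r ≤ j + 1 then
        (q ^ r * (poch q r)⁻¹) • downOp (j + 1 - r) (skewOp q (n + 1 - r) φ) else 0 := by
    simp only [commOp, smul_sum]
    rw [sum_comm' (t' := range (n + 1 + 1)) (s' := fun r => range (n + 1 - r + 1))
      (fun x y => by simp only [mem_range]; omega)]
    refine sum_congr rfl fun r hr => ?_
    split_ifs with hrj
    · rw [skewOp_rec h1 h2 (n + 1 - r), map_sum, smul_sum]
      refine sum_congr rfl fun i hi => ?_
      rw [mem_range] at hi hr
      rw [map_smul, smul_smul, smul_smul, Nat.sub_right_comm, show n + 1 - i = r + (n + 1 - r - i) by omega,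
        pow_add]
      congr 1
      ring
    · exact sum_eq_zero fun i _ => smul_zero _
  rw [hsw, commOp, commOp, sum_range_succ', sum_range_succ' _ (n + 1), ← add_assoc, ← sum_add_distrib]
  congr 1
  · refine sum_congr rfl fun r _ => ?_
    simp only [Nat.add_sub_add_right, Nat.add_le_add_iff_right]
    split_ifs
    · rw [← add_smul, ← inv_poch_succ h1 h2]
    · rw [add_zero]
  · simp

theorem skewOp_downOp {q : ℝ} (h1 : q ≠ 1) (h2 : q ≠ -1) (n : ℕ) :
    ∀ (j : ℕ) (φ : YoungDiagram → ℝ), skewOp q n (downOp j φ) = commOp q n j φ := by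
  induction n using Nat.strong_induction_on with
  | _ n ih =>
    intro j φ
    rcases n with _ | n
    · simp [commOp, skewOp_zero, poch_zero]
    rcases j with _ | j
    · rw [downOp_zero, commOp, sum_range_succ', sum_eq_zero fun r _ => if_neg (by omega)]
      simp [downOp_zero, poch_zero]
    have hL : skewOp q (n + 1) (downOp (j + 1) φ) = skewOp q n (downOp j φ) +
        ∑ i ∈ range (n + 1 + 1), q ^ (n + 1 - i) • skewOp q (n + 1 - i) (downOp (j + 1) (upOp i φ)) := by
      rw [skewOp_rec h1 h2 (n + 1), skewOp_rec h1 h2 n, sum_range_succ', sum_range_succ' _ (n + 1),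
        ← add_assoc, ← sum_add_distrib]
      simp only [Nat.add_sub_add_right, upOp_zero, upOp_downOp, map_add, smul_add]
    have hC := commOp_succ h1 h2 n j φ
    rw [sum_range_succ'] at hL hC
    rw [ih n (by omega), sum_congr rfl fun i hi => by rw [ih _ (by omega)]] at hL
    simp only [upOp_zero, Nat.sub_zero] at hL hC
    have h3 := one_sub_pow_ne_zero h1 h2 n
    funext α
    have hL' := congrFun hL α
    have hC' := congrFun hC α
    simp only [Pi.add_apply, Pi.smul_apply, smul_eq_mul] at hL' hC'
    refine mul_left_cancel₀ h3 ?_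
    linear_combination hL' - hC'

theorem skewOp_one_succ {q : ℝ} (h1 : q ≠ 1) (h2 : q ≠ -1) (n : ℕ) :
    skewOp q (n + 1) 1 = skewOp q n 1 + ∑ i ∈ range (n + 1 + 1), q ^ (n + 1 - i) •
      ∑ r ∈ range (n + 1 - i + 1), if r ≤ i then
        (poch q r)⁻¹ • downOp (i - r) (skewOp q (n + 1 - i - r) 1) else 0 := by
  have h : skewOp q (n + 1) 1 = skewOp q n 1 +
      ∑ i ∈ range (n + 1 + 1), q ^ (n + 1 - i) • skewOp q (n + 1 - i) (downOp i 1) := by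
    conv_lhs => rw [skewOp_rec h1 h2 (n + 1)]
    rw [skewOp_rec h1 h2 n, sum_range_succ', sum_range_succ' _ (n + 1),
        ← add_assoc, ← sum_add_distrib]
    simp only [Nat.add_sub_add_right, upOp_zero, downOp_zero, upOp_one, map_add, smul_add]
  rw [h]
  congr 1
  refine sum_congr rfl fun i _ => ?_
  rw [skewOp_downOp h1 h2, commOp]

/-- The sum of `skewNorm q n μ α` over all `μ`. -/
noncomputable def coNorm (q : ℝ) (n : ℕ) (α : YoungDiagram) : ℝ :=
  ∑ μ ∈ subDiagrams α, skewNorm q n μ α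

theorem coNorm_zero (q : ℝ) (α : YoungDiagram) : coNorm q 0 α = 1 := by
  classical
  simp only [coNorm, skewNorm_zero]
  rw [sum_ite_eq', if_pos (mem_subDiagrams.2 le_rfl)]

theorem coNorm_rec {q : ℝ} (h1 : q ≠ 1) (h2 : q ≠ -1) (n : ℕ) :
    coNorm q n = ∑ i ∈ range (n + 1), q ^ (n - i) • downOp i (coNorm q (n - i)) := by
  funext α
  rw [Finset.sum_apply]
  change _ = ∑ i ∈ range (n + 1), q ^ (n - i) * ∑ β ∈ stripDown α i, coNorm q (n - i) β
  rw [coNorm]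
  simp_rw [skewNorm_rec h1 h2 n _ α]
  rw [sum_comm]
  refine sum_congr rfl fun i _ => ?_
  rw [← mul_sum, sum_comm]
  congr 1
  refine sum_congr rfl fun β hβ => ?_
  symm
  refine sum_subset (fun μ hμ => ?_) fun μ _ hμ => ?_
  · exact mem_subDiagrams.2 ((mem_subDiagrams.1 hμ).trans (mem_stripDown.1 hβ).1.le)
  · exact skewNorm_eq_zero q _ fun h => hμ (mem_subDiagrams.2 h.1)

/-- The `q`-binomial coefficient in terms of `poch`. -/
noncomputable def pochBinom (q : ℝ) (r k : ℕ) : ℝ := poch q (r + k) / (poch q r * poch q k)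

theorem pochBinom_zero_left {q : ℝ} (h1 : q ≠ 1) (h2 : q ≠ -1) (k : ℕ) : pochBinom q 0 k = 1 := by
  rw [pochBinom, poch_zero, one_mul, Nat.zero_add, div_self (poch_ne_zero h1 h2 k)]

theorem pochBinom_zero_right {q : ℝ} (h1 : q ≠ 1) (h2 : q ≠ -1) (r : ℕ) : pochBinom q r 0 = 1 := by
  rw [pochBinom, poch_zero, mul_one, Nat.add_zero, div_self (poch_ne_zero h1 h2 r)]

theorem pochBinom_succ_succ {q : ℝ} (h1 : q ≠ 1) (h2 : q ≠ -1) (r k : ℕ) :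
    pochBinom q (r + 1) (k + 1) =
      pochBinom q r (k + 1) + q ^ (r + 1) * pochBinom q (r + 1) k := by
  have hr := poch_ne_zero h1 h2 r
  have hk := poch_ne_zero h1 h2 k
  have hr1 := one_sub_pow_ne_zero h1 h2 r
  have hk1 := one_sub_pow_ne_zero h1 h2 k
  simp only [pochBinom, show r + 1 + (k + 1) = r + k + 1 + 1 by omega,
    show r + (k + 1) = r + k + 1 by omega, show r + 1 + k = r + k + 1 by omega, poch_succ]
  field_simp
  ring

theorem pochBinom_succ_succ' {q : ℝ} (h1 : q ≠ 1) (h2 : q ≠ -1) (r k : ℕ) :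
    pochBinom q (r + 1) (k + 1) =
      q ^ (k + 1) * pochBinom q r (k + 1) + pochBinom q (r + 1) k := by
  have hr := poch_ne_zero h1 h2 r
  have hk := poch_ne_zero h1 h2 k
  have hr1 := one_sub_pow_ne_zero h1 h2 r
  have hk1 := one_sub_pow_ne_zero h1 h2 k
  simp only [pochBinom, show r + 1 + (k + 1) = r + k + 1 + 1 by omega,
    show r + (k + 1) = r + k + 1 by omega, show r + 1 + k = r + k + 1 by omega, poch_succ]
  field_simp
  ring

theorem sum_powersetCard_range_succ (m r : ℕ) (F : Finset ℕ → ℝ) :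
    ∑ R ∈ powersetCard (r + 1) (range (m + 1)), F R =
      ∑ R ∈ powersetCard (r + 1) (range m), F R + ∑ R ∈ powersetCard r (range m), F (insert m R) := by
  have hm : ∀ k, ∀ R ∈ powersetCard k (range m), m ∉ R := fun k R hR hmR =>
    absurd (mem_range.1 ((mem_powersetCard.1 hR).1 hmR)) (lt_irrefl _)
  rw [range_add_one, powersetCard_succ_insert notMem_range_self, sum_union, sum_image]
  · intro R hR R' hR' h
    rw [← erase_insert (hm _ R hR), h, erase_insert (hm _ R' hR')]
  · refine disjoint_left.2 fun R hR hR' => ?_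
    obtain ⟨R'', -, rfl⟩ := mem_image.1 hR'
    exact hm _ _ hR (mem_insert_self _ _)

/-- The descents of a word obtained by inserting an increasing sequence of large letters at the
positions in `R` into a word with descents `d`. -/
def ShuffleDesc (R : Finset ℕ) (d : ℕ → Prop) (p : ℕ) : Prop :=
  p + 1 ∉ R ∧ (p ∈ R ∨ d (#{x ∈ range p | x ∉ R}))

theorem card_filter_notMem {R : Finset ℕ} {m r : ℕ} (h : R ∈ powersetCard r (range m)) :
    #{x ∈ range m | x ∉ R} = m - r := by
  rw [mem_powersetCard] at h
  rw [filter_notMem_eq_sdiff, card_sdiff_of_subset h.1, card_range, h.2]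

theorem descSum_shuffleDesc_insert {R : Finset ℕ} {d : ℕ → Prop} {m : ℕ} :
    descSum (ShuffleDesc (insert m R) d) (m + 1) = descSum (ShuffleDesc R d) m := by
  rcases m with _ | m
  · rw [descSum_one, descSum_zero]
  rw [descSum_succ_succ, if_neg fun h => h.1 (mem_insert_self _ _), add_zero]
  refine descSum_congr fun p hp => ?_
  have h1 : p + 1 ∉ insert (m + 1) R ↔ p + 1 ∉ R := by
    rw [mem_insert, not_or, and_iff_right (by omega)]
  have h2 : p ∈ insert (m + 1) R ↔ p ∈ R := by
    rw [mem_insert, or_iff_right (by omega)]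
  have h3 : {x ∈ range p | x ∉ insert (m + 1) R} = {x ∈ range p | x ∉ R} := by
    refine filter_congr fun x hx => ?_
    rw [mem_range] at hx
    rw [mem_insert, not_or, and_iff_right (by omega)]
  rw [ShuffleDesc, ShuffleDesc, h1, h2, h3]

open scoped Classical in
theorem sum_shuffle_aux {q : ℝ} (h1 : q ≠ 1) (h2 : q ≠ -1) (d : ℕ → Prop) (m : ℕ) :
    ∀ r k, r + k = m →
      ∑ R ∈ powersetCard r (range m), q ^ descSum (ShuffleDesc R d) m =
        q ^ descSum d k * pochBinom q r k ∧
      ∑ R ∈ powersetCard r (range m), q ^ descSum (ShuffleDesc R d) (m + 1) =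
        q ^ descSum d (k + 1) * (q ^ r * pochBinom q r k) := by
  induction m with
  | zero =>
    intro r k h
    obtain ⟨rfl, rfl⟩ : r = 0 ∧ k = 0 := by omega
    simp [descSum_zero, descSum_one, pochBinom, poch_zero]
  | succ m ih =>
    intro r k h
    have hin : ∀ r, ∀ R ∈ powersetCard r (range m), q ^ descSum (ShuffleDesc R d) (m + 1 + 1) =
        (if d (m - r) then q ^ (m + 1) else 1) * q ^ descSum (ShuffleDesc R d) (m + 1) := by
      intro r R hR
      have hR2 := (mem_powersetCard.1 hR).1
      have hm0 : m ∉ R := fun hmR => by have := mem_range.1 (hR2 hmR); omega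
      have hm1 : m + 1 ∉ R := fun hmR => by have := mem_range.1 (hR2 hmR); omega
      rw [descSum_succ_succ, pow_add, mul_comm]
      congr 1
      have : ShuffleDesc R d m ↔ d (m - r) := by
        rw [ShuffleDesc, card_filter_notMem hR]
        tauto
      by_cases hd : d (m - r)
      · rw [if_pos hd, if_pos (this.2 hd)]
      · rw [if_neg hd, if_neg fun h => hd (this.1 h), pow_zero]
    have hout : ∀ r, ∀ R ∈ powersetCard r (range m),
        q ^ descSum (ShuffleDesc (insert m R) d) (m + 1 + 1) =
        q ^ (m + 1) * q ^ descSum (ShuffleDesc R d) m := by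
      intro r R hR
      have hR2 := (mem_powersetCard.1 hR).1
      have hm1 : m + 1 ∉ insert m R := fun hmR => by
        rcases mem_insert.1 hmR with h | h
        · omega
        · have := mem_range.1 (hR2 h); omega
      rw [descSum_succ_succ, if_pos ⟨hm1, Or.inl (mem_insert_self _ _)⟩, pow_add, mul_comm,
        descSum_shuffleDesc_insert]
    rcases r with _ | r
    · obtain rfl : k = m + 1 := by omega
      have h3 := ih 0 m (by omega)
      have h4 := hin 0 ∅ (by simp)
      simp only [powersetCard_zero, sum_singleton] at h3 ⊢
      rw [h4, h3.2, pochBinom_zero_left h1 h2,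
        pochBinom_zero_left h1 h2, descSum_succ_succ, pow_add, Nat.sub_zero]
      refine ⟨by ring, ?_⟩
      split_ifs <;> ring
    have hs := ih r k (by omega)
    rw [sum_powersetCard_range_succ, sum_powersetCard_range_succ, sum_congr rfl (hin (r + 1)),
      ← mul_sum, sum_congr rfl (hout r), ← mul_sum]
    simp only [descSum_shuffleDesc_insert]
    rw [hs.1]
    rcases k with _ | k
    · rw [powersetCard_eq_empty.2 (by rw [card_range]; omega), sum_empty,
        pochBinom_zero_right h1 h2, pochBinom_zero_right h1 h2, descSum_zero, descSum_one,
        show m = r by omega]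
      exact ⟨by ring, by ring⟩
    · rw [(ih (r + 1) k (by omega)).2, show m - (r + 1) = k by omega,
        show m + 1 = k + 1 + (r + 1) by omega, descSum_succ_succ d k, pow_add q (descSum d (k + 1))]
      refine ⟨?_, ?_⟩
      · rw [pochBinom_succ_succ h1 h2]; ring
      · split_ifs
        · rw [pochBinom_succ_succ h1 h2]; ring
        · rw [pochBinom_succ_succ' h1 h2]; ring

theorem sum_shuffle {q : ℝ} (h1 : q ≠ 1) (h2 : q ≠ -1) (d : ℕ → Prop) (r k : ℕ) :
    ∑ R ∈ powersetCard r (range (r + k)), q ^ descSum (ShuffleDesc R d) (r + k) =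
      q ^ descSum d k * pochBinom q r k :=
  (sum_shuffle_aux h1 h2 d _ r k rfl).1

/-- The permutation `π` has a descent at the position `p`. -/
def PermDesc {n : ℕ} (π : Equiv.Perm (Fin n)) (p : ℕ) : Prop :=
  ∃ h : p + 1 < n, π ⟨p + 1, h⟩ < π ⟨p, by omega⟩

theorem maj_eq {n : ℕ} (π : Equiv.Perm (Fin n)) : maj π = descSum (PermDesc π) n := by
  unfold maj descSum
  refine sum_congr rfl fun p _ => ?_
  by_cases hp : p + 1 < n
  · rw [dif_pos hp]
    by_cases hd : π ⟨p + 1, hp⟩ < π ⟨p, by omega⟩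
    · rw [if_pos hd, if_pos ⟨hp, hp, hd⟩]
    · rw [if_neg hd, if_neg fun h => hd h.2.2]
  · rw [dif_neg hp, if_neg fun h => hp h.1]

/-- An involution which is increasing on the positions `≥ m` and such that `R` is the set
of positions `< m` which are sent to positions `≥ m`. -/
structure IsMatching {n : ℕ} (m : ℕ) (R : Finset ℕ) (π : Equiv.Perm (Fin n)) : Prop where
  invol : ∀ x, π (π x) = x
  mono : ∀ x y : Fin n, m ≤ (x : ℕ) → x < y → π x < π y
  mem_iff : ∀ x : Fin n, (x : ℕ) ∈ R ↔ (x : ℕ) < m ∧ m ≤ (π x : ℕ)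

/-- The positions `< m` which are not in `R`. -/
def coSet (n m : ℕ) (R : Finset ℕ) : Finset (Fin n) :=
  univ.filter fun x => (x : ℕ) < m ∧ (x : ℕ) ∉ R

theorem mem_coSet {n m : ℕ} {R : Finset ℕ} {x : Fin n} :
    x ∈ coSet n m R ↔ (x : ℕ) < m ∧ (x : ℕ) ∉ R := by
  rw [coSet, mem_filter, and_iff_right (mem_univ x)]

theorem card_coSet {m i r : ℕ} {R : Finset ℕ} (hR : R ∈ powersetCard r (range m)) :
    (coSet (m + i) m R).card = m - r := by
  rw [← card_filter_notMem hR]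
  refine card_bij (fun x _ => (x : ℕ)) ?_ ?_ ?_
  · intro x hx
    rw [mem_filter, mem_range]
    exact mem_coSet.1 hx
  · exact fun x _ y _ h => Fin.ext h
  · intro p hp
    rw [mem_filter, mem_range] at hp
    exact ⟨⟨p, by omega⟩, mem_coSet.2 hp, rfl⟩

theorem IsMatching.card_le {m i : ℕ} {R : Finset ℕ} {π : Equiv.Perm (Fin (m + i))}
    (h : IsMatching m R π) (hR : R ⊆ range m) : R.card ≤ i := by
  have h1 : #(univ.filter fun x : Fin (m + i) => m ≤ (x : ℕ)) ≤ i := by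
    refine le_of_le_of_eq ?_ (card_range i)
    refine card_le_card_of_injOn (fun x => (x : ℕ) - m) ?_ ?_
    · intro x hx
      have := x.2
      simp only [coe_filter, mem_univ, true_and, Set.mem_ofPred_eq, coe_range, Set.mem_Iio] at hx ⊢
      omega
    · intro x hx y hy hxy
      simp only [coe_filter, mem_univ, true_and, Set.mem_ofPred_eq] at hx hy hxy
      exact Fin.ext (by omega)
  refine le_trans ?_ h1
  refine card_le_card_of_surjOn (fun x => ((π x : Fin (m + i)) : ℕ)) ?_
  intro p hp
  have hp2 := mem_range.1 (hR hp)
  have h2 := (h.mem_iff ⟨p, by omega⟩).1 hp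
  refine ⟨π ⟨p, by omega⟩, ?_, ?_⟩
  · simpa using h2.2
  · simp only [h.invol]

theorem IsMatching.le_iff {n m : ℕ} {R : Finset ℕ} {π ρ : Equiv.Perm (Fin n)}
    (hπ : IsMatching m R π) (hρ : IsMatching m R ρ) (x : Fin n) :
    m ≤ (π x : ℕ) ↔ m ≤ (ρ x : ℕ) := by
  by_cases hx : (x : ℕ) < m
  · have h1 := hπ.mem_iff x
    have h2 := hρ.mem_iff x
    tauto
  have hcard : ∀ τ : Equiv.Perm (Fin n), IsMatching m R τ →
      #(univ.filter fun x : Fin n => m ≤ (x : ℕ) ∧ (τ x : ℕ) < m) =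
        #(univ.filter fun x : Fin n => (x : ℕ) ∈ R) := by
    intro τ hτ
    refine card_nbij' τ τ ?_ ?_ ?_ ?_
    · intro y hy
      simp only [coe_filter, mem_univ, true_and, Set.mem_ofPred_eq, hτ.mem_iff, hτ.invol] at hy ⊢
      exact hy.symm
    · intro y hy
      simp only [coe_filter, mem_univ, true_and, Set.mem_ofPred_eq, hτ.mem_iff, hτ.invol] at hy ⊢
      exact hy.symm
    · exact fun y _ => hτ.invol y
    · exact fun y _ => hτ.invol y
  have hlow : ∀ τ : Equiv.Perm (Fin n), IsMatching m R τ → ∀ x y : Fin n, m ≤ (x : ℕ) → x ≤ y →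
      (τ y : ℕ) < m → (τ x : ℕ) < m := by
    intro τ hτ x y hx hxy hy
    rcases hxy.eq_or_lt with rfl | hxy
    · exact hy
    · exact lt_trans (hτ.mono x y hx hxy) hy
  have hnest : ∀ τ υ : Equiv.Perm (Fin n), IsMatching m R τ → IsMatching m R υ → ∀ x : Fin n,
      m ≤ (x : ℕ) → m ≤ (τ x : ℕ) → m ≤ (υ x : ℕ) := by
    intro τ υ hτ hυ x hx h1
    by_contra! h2
    have hsub : (univ.filter fun x : Fin n => m ≤ (x : ℕ) ∧ (τ x : ℕ) < m) ⊆
        univ.filter fun x : Fin n => m ≤ (x : ℕ) ∧ (υ x : ℕ) < m := by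
      intro y hy
      simp only [mem_filter, mem_univ, true_and] at hy ⊢
      refine ⟨hy.1, ?_⟩
      rcases le_total x y with h | h
      · have := hlow τ hτ x y hx h hy.2
        omega
      · exact hlow υ hυ y x hy.1 h h2
    have heq := eq_of_subset_of_card_le hsub (by rw [hcard τ hτ, hcard υ hυ])
    have hmem : x ∈ univ.filter fun x : Fin n => m ≤ (x : ℕ) ∧ (υ x : ℕ) < m := by
      simp [hx, h2]
    rw [← heq] at hmem
    simp only [mem_filter, mem_univ, true_and] at hmem
    omega
  exact ⟨hnest π ρ hπ hρ x (by omega), hnest ρ π hρ hπ x (by omega)⟩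

theorem IsMatching.eq_of_notMem {n m : ℕ} {R : Finset ℕ} {π ρ : Equiv.Perm (Fin n)}
    (hπ : IsMatching m R π) (hρ : IsMatching m R ρ) {x : Fin n} (hx : x ∉ coSet n m R) :
    π x = ρ x := by
  have hrange : ∀ τ : Equiv.Perm (Fin n), IsMatching m R τ →
      Set.range (fun x : {x : Fin n // m ≤ (x : ℕ)} => τ x) = {x | m ≤ (τ x : ℕ)} := by
    intro τ hτ
    ext y
    constructor
    · rintro ⟨z, rfl⟩
      simp only [Set.mem_ofPred_eq, hτ.invol]
      exact z.2
    · intro hy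
      exact ⟨⟨τ y, hy⟩, hτ.invol y⟩
  have hmono : ∀ τ : Equiv.Perm (Fin n), IsMatching m R τ →
      StrictMono (fun x : {x : Fin n // m ≤ (x : ℕ)} => τ x) :=
    fun τ hτ y z hyz => hτ.mono y z y.2 hyz
  have heq : (fun x : {x : Fin n // m ≤ (x : ℕ)} => π x) =
      fun x : {x : Fin n // m ≤ (x : ℕ)} => ρ x := by
    rw [← (hmono π hπ).range_inj (hmono ρ hρ), hrange π hπ, hrange ρ hρ]
    ext y
    exact hπ.le_iff hρ y
  have hle : ∀ y : Fin n, m ≤ (y : ℕ) → π y = ρ y := fun y hy => congrFun heq ⟨y, hy⟩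
  by_cases hm : m ≤ (x : ℕ)
  · exact hle x hm
  · have hR : (x : ℕ) ∈ R := by
      by_contra h
      exact hx (mem_coSet.2 ⟨by omega, h⟩)
    have h1 := hle (π x) ((hπ.mem_iff x).1 hR).2
    rw [hπ.invol] at h1
    conv_rhs => rw [h1]
    exact (hρ.invol _).symm

theorem exists_isMatching {m i : ℕ} {R : Finset ℕ} (hR : R ⊆ range m) (hi : R.card ≤ i) :
    ∃ π : Equiv.Perm (Fin (m + i)), IsMatching m R π ∧ ∀ x ∈ coSet (m + i) m R, π x = x := by
  have g := R.orderIsoOfFin rfl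
  have hlt : ∀ x ∈ R, x < m := fun x hx => mem_range.1 (hR hx)
  have hgR : ∀ k, (g k : ℕ) ∈ R := fun k => (g k).2
  let F : Fin (m + i) → Fin (m + i) := fun x =>
    if hx : (x : ℕ) ∈ R then ⟨m + (g.symm ⟨x, hx⟩ : ℕ), by omega⟩
    else if hx2 : m ≤ (x : ℕ) ∧ (x : ℕ) < m + R.card then
      ⟨g ⟨(x : ℕ) - m, by omega⟩, by have := hlt _ (hgR ⟨(x : ℕ) - m, by omega⟩); omega⟩
    else x
  have hF1 : ∀ (x : Fin (m + i)) (hx : (x : ℕ) ∈ R), (F x : ℕ) = m + (g.symm ⟨x, hx⟩ : ℕ) := by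
    intro x hx
    simp only [F, dif_pos hx]
  have hF2 : ∀ (x : Fin (m + i)) (hx : m ≤ (x : ℕ) ∧ (x : ℕ) < m + R.card),
      (F x : ℕ) = g ⟨(x : ℕ) - m, by omega⟩ := by
    intro x hx
    have h1 : (x : ℕ) ∉ R := fun h => by have := hlt _ h; omega
    simp only [F, dif_neg h1, dif_pos hx]
  have hF3 : ∀ (x : Fin (m + i)), (x : ℕ) ∉ R → ¬ (m ≤ (x : ℕ) ∧ (x : ℕ) < m + R.card) →
      F x = x := by
    intro x h1 h2
    simp only [F, dif_neg h1, dif_neg h2]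
  have hinv : Function.Involutive F := by
    intro x
    by_cases hx : (x : ℕ) ∈ R
    · have h1 := hF1 x hx
      apply Fin.ext
      rw [hF2 _ (by omega)]
      simp only [h1, Nat.add_sub_cancel_left, Fin.eta, OrderIso.apply_symm_apply]
    by_cases hx2 : m ≤ (x : ℕ) ∧ (x : ℕ) < m + R.card
    · have h1 := hF2 x hx2
      apply Fin.ext
      rw [hF1 _ (h1 ▸ hgR _)]
      simp only [h1, Subtype.coe_eta, OrderIso.symm_apply_apply]
      omega
    · rw [hF3 x hx hx2, hF3 x hx hx2]
  refine ⟨hinv.toPerm F, ⟨hinv, ?_, ?_⟩, ?_⟩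
  · intro x y hx hxy
    change F x < F y
    have hxR : (x : ℕ) ∉ R := fun h => by have := hlt _ h; omega
    have hyR : (y : ℕ) ∉ R := fun h => by have := hlt _ h; omega
    rw [Fin.lt_def] at hxy ⊢
    by_cases hy : (y : ℕ) < m + R.card
    · rw [hF2 x (by omega), hF2 y (by omega)]
      have : g ⟨(x : ℕ) - m, by omega⟩ < g ⟨(y : ℕ) - m, by omega⟩ :=
        g.strictMono (by rw [Fin.mk_lt_mk]; omega)
      exact this
    · rw [hF3 y hyR (by omega)]
      by_cases hx2 : (x : ℕ) < m + R.card
      · rw [hF2 x (by omega)]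
        have := hlt _ (hgR ⟨(x : ℕ) - m, by omega⟩)
        omega
      · rw [hF3 x hxR (by omega)]
        exact hxy
  · intro x
    change _ ↔ _ ∧ m ≤ (F x : ℕ)
    constructor
    · intro hx
      rw [hF1 x hx]
      exact ⟨hlt _ hx, by omega⟩
    · rintro ⟨h1, h2⟩
      by_contra hx
      rw [hF3 x hx (by omega)] at h2
      omega
  · intro x hx
    rw [mem_coSet] at hx
    exact hF3 x hx.2 (by omega)

theorem card_filter_lt_eq {n m k : ℕ} {R : Finset ℕ} (f : Fin k ≃o coSet n m R) (j : Fin k) :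
    #{z ∈ range ((f j : Fin n) : ℕ) | z ∉ R} = j := by
  rw [← Fin.card_Iio j]
  symm
  refine card_bij (fun a _ => ((f a : Fin n) : ℕ)) ?_ ?_ ?_
  · intro a ha
    rw [mem_filter, mem_range]
    exact ⟨f.strictMono (mem_Iio.1 ha), (mem_coSet.1 (f a).2).2⟩
  · intro a _ b _ h
    exact f.injective (Subtype.ext (Fin.ext h))
  · intro z hz
    rw [mem_filter, mem_range] at hz
    have h1 := (mem_coSet.1 (f j).2).1
    have h2 : (⟨z, by omega⟩ : Fin n) ∈ coSet n m R := mem_coSet.2 ⟨by dsimp only; omega, hz.2⟩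
    refine ⟨f.symm ⟨_, h2⟩, ?_, ?_⟩
    · rw [mem_Iio, ← f.lt_iff_lt, f.apply_symm_apply]
      exact hz.1
    · rw [f.apply_symm_apply]

open scoped Classical in
theorem sum_isMatching {m i r : ℕ} {R : Finset ℕ} (hR : R ∈ powersetCard r (range m)) (hi : r ≤ i)
    (q : ℝ) :
    ∑ π ∈ univ.filter (fun π : Equiv.Perm (Fin (m + i)) => IsMatching m R π),
      q ^ descSum (PermDesc π) m =
    ∑ σ ∈ involutions (m - r), q ^ descSum (ShuffleDesc R (PermDesc σ)) m := by
  have hsub := (mem_powersetCard.1 hR).1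
  obtain ⟨π₀, hπ₀, hfix⟩ := exists_isMatching (i := i) hsub (by rw [(mem_powersetCard.1 hR).2]; exact hi)
  have f := (coSet (m + i) m R).orderIsoOfFin (card_coSet hR)
  let Φ : Equiv.Perm (Fin (m - r)) → Equiv.Perm (Fin (m + i)) :=
    fun σ => π₀ * σ.extendDomain f.toEquiv
  have hΦ1 : ∀ σ k, Φ σ (f k) = f (σ k) := by
    intro σ k
    change π₀ (σ.extendDomain f.toEquiv (f.toEquiv k)) = _
    rw [Equiv.Perm.extendDomain_apply_image]
    exact hfix _ (f (σ k)).2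
  have hΦ2 : ∀ σ, ∀ x ∉ coSet (m + i) m R, Φ σ x = π₀ x := by
    intro σ x hx
    change π₀ (σ.extendDomain f.toEquiv x) = _
    rw [Equiv.Perm.extendDomain_apply_not_subtype _ _ hx]
  have hsurj : ∀ x ∈ coSet (m + i) m R, ∃ k, x = f k := fun x hx =>
    ⟨f.symm ⟨x, hx⟩, by rw [f.apply_symm_apply]⟩
  have hmatch : ∀ σ ∈ involutions (m - r), IsMatching m R (Φ σ) := by
    intro σ hσ
    rw [involutions, mem_filter] at hσ
    refine ⟨?_, ?_, ?_⟩
    · intro x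
      by_cases hx : x ∈ coSet (m + i) m R
      · obtain ⟨k, rfl⟩ := hsurj x hx
        rw [hΦ1, hΦ1]
        have := DFunLike.congr_fun hσ.2 k
        rw [Equiv.Perm.mul_apply, Equiv.Perm.one_apply] at this
        rw [this]
      · have h1 : π₀ x ∉ coSet (m + i) m R := by
          intro h
          have h2 := hfix _ h
          rw [π₀.injective h2] at h
          exact hx h
        rw [hΦ2 σ x hx, hΦ2 σ _ h1, hπ₀.invol]
    · intro x y hx hxy
      have hnot : ∀ z : Fin (m + i), m ≤ (z : ℕ) → z ∉ coSet (m + i) m R := fun z hz h => by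
        have := (mem_coSet.1 h).1
        omega
      rw [hΦ2 σ x (hnot x hx), hΦ2 σ y (hnot y (hx.trans hxy.le))]
      exact hπ₀.mono x y hx hxy
    · intro x
      by_cases hx : x ∈ coSet (m + i) m R
      · have h1 := mem_coSet.1 hx
        obtain ⟨k, rfl⟩ := hsurj x hx
        have h2 := (mem_coSet.1 (f (σ k)).2).1
        rw [hΦ1]
        have : ¬ m ≤ ((f (σ k) : Fin (m + i)) : ℕ) := by omega
        tauto
      · rw [hΦ2 σ x hx]
        exact hπ₀.mem_iff x
  symm
  refine sum_bij (fun σ _ => Φ σ) ?_ ?_ ?_ ?_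
  · intro σ hσ
    rw [mem_filter]
    exact ⟨mem_univ _, hmatch σ hσ⟩
  · intro σ _ τ _ h
    refine Equiv.ext fun k => f.injective (Subtype.ext ?_)
    rw [← hΦ1, ← hΦ1, h]
  · intro π hπ
    rw [mem_filter, and_iff_right (mem_univ π)] at hπ
    have hC : ∀ x, x ∈ coSet (m + i) m R → π x ∈ coSet (m + i) m R := by
      intro x hx
      rw [mem_coSet] at hx ⊢
      have h1 := hπ.mem_iff x
      have h2 := hπ.mem_iff (π x)
      rw [hπ.invol] at h2
      have h3 : ¬ m ≤ (π x : ℕ) := fun h => hx.2 (h1.2 ⟨hx.1, h⟩)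
      exact ⟨by omega, fun h => absurd (h2.1 h).2 (by omega)⟩
    let F : Fin (m - r) → Fin (m - r) := fun k => f.symm ⟨π (f k), hC _ (f k).2⟩
    have hF : ∀ k, (f (F k) : Fin (m + i)) = π (f k) := fun k => by
      simp only [F, OrderIso.apply_symm_apply]
    have hFinv : Function.Involutive F := by
      intro k
      refine f.injective (Subtype.ext ?_)
      rw [hF, hF, hπ.invol]
    have hmem : hFinv.toPerm F ∈ involutions (m - r) := by
      rw [involutions, mem_filter]
      exact ⟨mem_univ _, Equiv.ext fun k => hFinv k⟩
    refine ⟨hFinv.toPerm F, hmem, Equiv.ext fun x => ?_⟩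
    by_cases hx : x ∈ coSet (m + i) m R
    · obtain ⟨k, rfl⟩ := hsurj x hx
      rw [hΦ1]
      exact hF k
    · exact (hmatch _ hmem).eq_of_notMem hπ hx
  · intro σ hσ
    congr 1
    have hM := hmatch σ hσ
    refine descSum_congr fun p hp => ?_
    have hPD : PermDesc (Φ σ) p ↔
        Φ σ (⟨p + 1, by omega⟩ : Fin (m + i)) < Φ σ (⟨p, by omega⟩ : Fin (m + i)) :=
      ⟨fun h => h.2, fun h => ⟨_, h⟩⟩
    rw [ShuffleDesc, hPD]
    generalize hx : (⟨p, by omega⟩ : Fin (m + i)) = x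
    generalize hy : (⟨p + 1, by omega⟩ : Fin (m + i)) = y
    have hxp : (x : ℕ) = p := by rw [← hx]
    have hyp : (y : ℕ) = p + 1 := by rw [← hy]
    have hmx := hM.mem_iff x
    have hmy := hM.mem_iff y
    rw [hxp] at hmx
    rw [hyp] at hmy
    by_cases hyR : p + 1 ∈ R
    · refine iff_of_false (fun h => h.1 hyR) fun h => ?_
      have hy2 := (hmy.1 hyR).2
      by_cases hxR : p ∈ R
      · have h3 := hM.mono _ _ hy2 h
        rw [hM.invol, hM.invol, Fin.lt_def] at h3
        omega
      · have h4 : ¬ m ≤ (Φ σ x : ℕ) := fun h5 => hxR (hmx.2 ⟨by omega, h5⟩)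
        rw [Fin.lt_def] at h
        omega
    · rw [and_iff_right hyR]
      have h4 : ¬ m ≤ (Φ σ y : ℕ) := fun h5 => hyR (hmy.2 ⟨hp, h5⟩)
      by_cases hxR : p ∈ R
      · have hx2 := (hmx.1 hxR).2
        refine iff_of_true (Or.inl hxR) ?_
        rw [Fin.lt_def]
        omega
      · rw [or_iff_right hxR]
        obtain ⟨a, ha⟩ := hsurj x (mem_coSet.2 (by rw [hxp]; exact ⟨by omega, hxR⟩))
        obtain ⟨b, hb⟩ := hsurj y (mem_coSet.2 (by rw [hyp]; exact ⟨hp, hyR⟩))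
        have hca := card_filter_lt_eq f a
        have hcb := card_filter_lt_eq f b
        rw [← ha, hxp] at hca
        rw [← hb, hyp, range_add_one, filter_insert, if_pos hxR, card_insert_of_notMem (by simp), hca] at hcb
        have hb' : b = ⟨a + 1, by omega⟩ := Fin.ext hcb.symm
        rw [hca, ha, hb, hΦ1, hΦ1, Subtype.coe_lt_coe, f.lt_iff_lt, hb', PermDesc]
        exact ⟨fun h => h.2, fun h => ⟨_, h⟩⟩

open scoped Classical in
theorem sum_involutions_increasing {q : ℝ} (h1 : q ≠ 1) (h2 : q ≠ -1) (m i : ℕ) :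
    ∑ π ∈ (involutions (m + i)).filter
        (fun π => ∀ j, m ≤ j → j + 1 < m + i → ¬ PermDesc π j), q ^ descSum (PermDesc π) m =
      ∑ r ∈ range (m + 1), if r ≤ i then pochBinom q r (m - r) * tq q (m - r) else 0 := by
  let ρ : Equiv.Perm (Fin (m + i)) → Finset ℕ := fun π =>
    (range m).filter fun p => ∃ h : p < m + i, m ≤ (π ⟨p, h⟩ : ℕ)
  have hfib : ∀ R ∈ (range m).powerset, ∀ π : Equiv.Perm (Fin (m + i)),
      ((π ∈ involutions (m + i) ∧ ∀ j, m ≤ j → j + 1 < m + i → ¬ PermDesc π j) ∧ ρ π = R) ↔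
        IsMatching m R π := by
    intro R hR π
    rw [mem_powerset] at hR
    constructor
    · rintro ⟨⟨h3, h4⟩, rfl⟩
      rw [involutions, mem_filter] at h3
      refine ⟨fun x => DFunLike.congr_fun h3.2 x, ?_, ?_⟩
      · intro x y hx hxy
        have hind : ∀ b, (x : ℕ) + 1 ≤ b → ∀ hb : b < m + i, π x < π ⟨b, hb⟩ := by
          have hstep : ∀ c (hc : c + 1 < m + i), (x : ℕ) ≤ c → π ⟨c, by omega⟩ < π ⟨c + 1, hc⟩ := by
            intro c hc hxc
            refine lt_of_le_of_ne (not_lt.1 fun h => h4 c (by omega) hc ⟨hc, h⟩) fun h => ?_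
            have := congrArg Fin.val (π.injective h)
            simp at this
          intro b hb
          induction b, hb using Nat.le_induction with
          | base => exact fun hb => hstep x hb le_rfl
          | succ b hxb ihb =>
            exact fun hb => (ihb (by omega)).trans (hstep b hb (by omega))
        exact hind y hxy y.2
      · intro x
        simp only [ρ, mem_filter, mem_range]
        exact ⟨fun h => ⟨h.1, h.2.2⟩, fun h => ⟨h.1, x.2, h.2⟩⟩
    · intro h
      refine ⟨⟨?_, ?_⟩, ?_⟩
      · rw [involutions, mem_filter]
        exact ⟨mem_univ _, Equiv.ext fun x => h.invol x⟩
      · rintro j hj _ ⟨hj2, hlt⟩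
        exact lt_asymm hlt (h.mono _ _ hj (by rw [Fin.mk_lt_mk]; omega))
      · ext p
        simp only [ρ, mem_filter, mem_range]
        constructor
        · rintro ⟨h3, h4, h5⟩
          exact (h.mem_iff ⟨p, h4⟩).2 ⟨h3, h5⟩
        · intro hp
          have h3 := mem_range.1 (hR hp)
          exact ⟨h3, by omega, ((h.mem_iff ⟨p, by omega⟩).1 hp).2⟩
  rw [← sum_fiberwise_of_maps_to (g := ρ) (t := (range m).powerset)
    (fun π _ => mem_powerset.2 (filter_subset _ _)), sum_powerset, card_range]
  refine sum_congr rfl fun r hr => ?_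
  have hset : ∀ R ∈ powersetCard r (range m), ((involutions (m + i)).filter
      (fun π => ∀ j, m ≤ j → j + 1 < m + i → ¬ PermDesc π j)).filter (fun π => ρ π = R) =
      univ.filter (fun π => IsMatching m R π) := by
    intro R hR
    ext π
    rw [mem_filter, mem_filter, mem_filter, and_iff_right (mem_univ π)]
    exact hfib R (mem_powerset.2 (mem_powersetCard.1 hR).1) π
  rw [sum_congr rfl fun R hR => by rw [hset R hR]]
  split_ifs with hri
  · rw [sum_congr rfl fun R hR => sum_isMatching hR hri q, sum_comm, tq, mul_sum]
    refine sum_congr rfl fun σ _ => ?_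
    have hm : m = r + (m - r) := by rw [mem_range] at hr; omega
    have h3 := sum_shuffle h1 h2 (PermDesc σ) r (m - r)
    rw [← hm] at h3
    rw [h3, maj_eq, mul_comm]
  · refine sum_eq_zero fun R hR => ?_
    rw [filter_false_of_mem, sum_empty]
    intro π _ h
    have := h.card_le (mem_powersetCard.1 hR).1
    rw [(mem_powersetCard.1 hR).2] at this
    exact hri this

/-- The normalised generating function of involutions. -/
noncomputable def invNorm (q : ℝ) (n : ℕ) : ℝ := tq q n / poch q n

theorem invNorm_zero (q : ℝ) : invNorm q 0 = 1 := by
  have : involutions 0 = {1} := by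
    ext π
    rw [involutions, mem_filter, mem_singleton]
    exact ⟨fun _ => Subsingleton.elim _ _, fun h => ⟨mem_univ _, Subsingleton.elim _ _⟩⟩
  rw [invNorm, poch_zero, div_one, tq, this, sum_singleton, maj_eq, descSum_zero, pow_zero]

theorem invNorm_rec {q : ℝ} (h1 : q ≠ 1) (h2 : q ≠ -1) (n : ℕ) :
    invNorm q n = ∑ i ∈ range (n + 1), q ^ (n - i) * ∑ r ∈ range (n - i + 1),
      if r ≤ i then (poch q r)⁻¹ * invNorm q (n - i - r) else 0 := by
  classical
  have hL : invNorm q n = ∑ π ∈ involutions n, q ^ descSum (PermDesc π) n / poch q n := by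
    rw [invNorm, tq, sum_div]
    exact sum_congr rfl fun c _ => by rw [maj_eq]
  rw [hL, sum_congr rfl fun c _ => pow_descSum_div_poch h1 h2 _ n, sum_comm]
  refine sum_congr rfl fun i hi => ?_
  rw [mem_range] at hi
  obtain ⟨m, rfl⟩ : ∃ m, n = m + i := ⟨n - i, by omega⟩
  rw [Nat.add_sub_cancel, ← sum_filter, ← mul_sum, ← sum_div,
    sum_involutions_increasing h1 h2, sum_div]
  congr 1
  refine sum_congr rfl fun r hr => ?_
  rw [mem_range] at hr
  split_ifs
  · have := poch_ne_zero h1 h2 m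
    rw [pochBinom, invNorm, show r + (m - r) = m by omega]
    field_simp
  · exact zero_div _

/-- The coefficients of the power series `∑ r, q ^ r / poch q r * X ^ (2 * r)`. -/
noncomputable def evenCoeff (q : ℝ) (k : ℕ) : ℝ :=
  if k % 2 = 0 then q ^ (k / 2) * (poch q (k / 2))⁻¹ else 0

theorem sum_eq_sum_evenCoeff (q : ℝ) (N : ℕ) (f : ℕ → ℕ → ℝ) :
    ∑ i ∈ range (N + 1), q ^ (N - i) * ∑ r ∈ range (N - i + 1),
        (if r ≤ i then (poch q r)⁻¹ * f (i - r) (N - i - r) else 0) =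
      ∑ k ∈ range (N + 1), evenCoeff q k *
        ∑ j ∈ range (N - k + 1), q ^ (N - k - j) * f j (N - k - j) := by
  simp only [mul_sum, evenCoeff, mul_ite, mul_zero, ite_mul, zero_mul]
  rw [sum_sigma', sum_sigma', ← sum_filter, ← sum_filter]
  refine sum_bij' (fun p _ => (⟨2 * p.2, p.1 - p.2⟩ : Σ _ : ℕ, ℕ))
    (fun p _ => (⟨p.2 + p.1 / 2, p.1 / 2⟩ : Σ _ : ℕ, ℕ)) ?_ ?_ ?_ ?_ ?_
  · rintro ⟨i, r⟩ h
    simp only [mem_filter, mem_sigma, mem_range] at h ⊢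
    omega
  · rintro ⟨k, j⟩ h
    simp only [mem_filter, mem_sigma, mem_range] at h ⊢
    omega
  · rintro ⟨i, r⟩ h
    simp only [mem_filter, mem_sigma, mem_range] at h ⊢
    rw [Sigma.mk.injEq]
    exact ⟨by omega, heq_of_eq (by omega)⟩
  · rintro ⟨k, j⟩ h
    simp only [mem_filter, mem_sigma, mem_range] at h ⊢
    rw [Sigma.mk.injEq]
    exact ⟨by omega, heq_of_eq (by omega)⟩
  · rintro ⟨i, r⟩ h
    simp only [mem_filter, mem_sigma, mem_range] at h ⊢
    rw [show 2 * r / 2 = r by omega, show N - 2 * r - (i - r) = N - i - r by omega,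
      show N - i = r + (N - i - r) by omega, pow_add, Nat.add_sub_cancel_left]
    ring

/-- The sum of the operators `downOp j` weighted by powers of `q`, acting on sequences. -/
noncomputable def downSeries (q : ℝ) (s : ℕ → YoungDiagram → ℝ) (n : ℕ) : YoungDiagram → ℝ :=
  ∑ j ∈ range (n + 1), q ^ (n - j) • downOp j (s (n - j))

theorem downSeries_apply (q : ℝ) (s : ℕ → YoungDiagram → ℝ) (n : ℕ) (α : YoungDiagram) :
    downSeries q s n α = ∑ j ∈ range (n + 1), q ^ (n - j) * downOp j (s (n - j)) α := by
  rw [downSeries, Finset.sum_apply]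
  rfl

/-- The recursion characterising both sides of the main identity. -/
def SatisfiesRec (q : ℝ) (s : ℕ → YoungDiagram → ℝ) : Prop :=
  ∀ α, s 0 α = 1 ∧ ∀ n, s (n + 1) α = s n α +
    ∑ k ∈ range (n + 1 + 1), evenCoeff q k * downSeries q s (n + 1 - k) α

theorem SatisfiesRec.unique {q : ℝ} (h1 : q ≠ 1) (h2 : q ≠ -1) {s t : ℕ → YoungDiagram → ℝ}
    (hs : SatisfiesRec q s) (ht : SatisfiesRec q t) (n : ℕ) : s n = t n := by
  induction n using Nat.strong_induction_on with
  | _ n ih =>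
    funext α
    rcases n with _ | n
    · rw [(hs α).1, (ht α).1]
    have hlow : ∀ m ≤ n, downSeries q s m α = downSeries q t m α := by
      intro m hm
      rw [downSeries_apply, downSeries_apply]
      refine sum_congr rfl fun j _ => ?_
      rw [ih (m - j) (by omega)]
    have htop : downSeries q s (n + 1) α - downSeries q t (n + 1) α =
        q ^ (n + 1) * (s (n + 1) α - t (n + 1) α) := by
      rw [downSeries_apply, downSeries_apply, sum_range_succ', sum_range_succ' _ (n + 1),
        sum_congr rfl fun j (_ : j ∈ range (n + 1)) =>
          (by rw [ih (n + 1 - (j + 1)) (by omega)] :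
            q ^ (n + 1 - (j + 1)) * downOp (j + 1) (s (n + 1 - (j + 1))) α =
            q ^ (n + 1 - (j + 1)) * downOp (j + 1) (t (n + 1 - (j + 1))) α),
        downOp_zero, downOp_zero, Nat.sub_zero]
      ring
    have h3 := (hs α).2 n
    have h4 := (ht α).2 n
    rw [sum_range_succ'] at h3 h4
    rw [sum_congr rfl fun k _ => by rw [hlow (n + 1 - (k + 1)) (by omega)], ih n (by omega)] at h3
    have h5 : evenCoeff q 0 = 1 := by simp [evenCoeff, poch_zero]
    rw [h5, one_mul, Nat.sub_zero] at h3 h4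
    have h6 := one_sub_pow_ne_zero h1 h2 n
    refine sub_eq_zero.1 ((mul_eq_zero.1 ?_).resolve_left h6)
    linear_combination h3 - h4 + htop

theorem satisfiesRec_skewOp_one {q : ℝ} (h1 : q ≠ 1) (h2 : q ≠ -1) :
    SatisfiesRec q fun n => skewOp q n 1 := by
  intro α
  refine ⟨congrFun (skewOp_zero q 1) α, fun n => ?_⟩
  have h := congrFun (skewOp_one_succ h1 h2 n) α
  dsimp only
  rw [h, Pi.add_apply]
  simp only [downSeries_apply]
  rw [← sum_eq_sum_evenCoeff q (n + 1) fun j l => downOp j (skewOp q l 1) α, Finset.sum_apply]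
  congr 1
  refine sum_congr rfl fun i _ => ?_
  rw [Pi.smul_apply, Finset.sum_apply, smul_eq_mul]
  congr 1
  refine sum_congr rfl fun r _ => ?_
  split_ifs <;> rfl

theorem downSeries_coNorm {q : ℝ} (h1 : q ≠ 1) (h2 : q ≠ -1) (n : ℕ) :
    downSeries q (coNorm q) n = coNorm q n :=
  (coNorm_rec h1 h2 n).symm

/-- The convolution of a sequence of numbers and a sequence of functions. -/
noncomputable def convSeq (a : ℕ → ℝ) (s : ℕ → YoungDiagram → ℝ) (n : ℕ) : YoungDiagram → ℝ :=
  ∑ k ∈ range (n + 1), a k • s (n - k)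

theorem downSeries_convSeq (q : ℝ) (a : ℕ → ℝ) (s : ℕ → YoungDiagram → ℝ) (n : ℕ) :
    downSeries q (convSeq a s) n = convSeq (fun k => q ^ k * a k) (downSeries q s) n := by
  simp only [downSeries, convSeq, map_sum, smul_sum, map_smul, smul_smul]
  rw [sum_comm' (t' := range (n + 1)) (s' := fun r => range (n - r + 1))
      (fun x y => by simp only [mem_range]; omega)]
  refine sum_congr rfl fun k hk => sum_congr rfl fun j hj => ?_
  rw [mem_range] at hk hj
  rw [Nat.sub_right_comm, show n - j = k + (n - k - j) by omega, pow_add]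
  congr 1
  ring

open PowerSeries in
theorem coeff_mk_mul_mk (a b : ℕ → ℝ) (n : ℕ) :
    coeff n (PowerSeries.mk a * PowerSeries.mk b) = ∑ k ∈ range (n + 1), a k * b (n - k) := by
  rw [coeff_mul, Nat.sum_antidiagonal_eq_sum_range_succ (fun i j => coeff i (PowerSeries.mk a) *
    coeff j (PowerSeries.mk b))]
  simp only [coeff_mk]

open PowerSeries in
theorem one_sub_X_mul_mk_eq_iff (s t : ℕ → ℝ) :
    (1 - X) * PowerSeries.mk s = PowerSeries.mk t ↔ s 0 = t 0 ∧ ∀ n, s (n + 1) = s n + t (n + 1) := by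
  rw [PowerSeries.ext_iff]
  constructor
  · intro h
    refine ⟨by simpa [sub_mul] using h 0, fun n => ?_⟩
    have := h (n + 1)
    rw [sub_mul, one_mul, map_sub, coeff_succ_X_mul, coeff_mk, coeff_mk, coeff_mk] at this
    linarith
  · rintro ⟨h0, h⟩ n
    rcases n with _ | n
    · simpa [sub_mul] using h0
    · rw [sub_mul, one_mul, map_sub, coeff_succ_X_mul, coeff_mk, coeff_mk, coeff_mk, h]
      ring

open PowerSeries in
theorem one_sub_X_mul_invNorm {q : ℝ} (h1 : q ≠ 1) (h2 : q ≠ -1) :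
    (1 - X) * PowerSeries.mk (invNorm q) =
      PowerSeries.mk (evenCoeff q) * PowerSeries.mk fun n => q ^ n * invNorm q n := by
  have hH : (1 - X) * PowerSeries.mk (fun n => ∑ j ∈ range (n + 1), q ^ (n - j) * invNorm q (n - j)) =
      PowerSeries.mk fun n => q ^ n * invNorm q n := by
    rw [one_sub_X_mul_mk_eq_iff]
    refine ⟨by simp, fun n => ?_⟩
    rw [sum_range_succ']
    simp only [Nat.add_sub_add_right, Nat.sub_zero]
  have hT : PowerSeries.mk (invNorm q) = PowerSeries.mk (evenCoeff q) *
      PowerSeries.mk (fun n => ∑ j ∈ range (n + 1), q ^ (n - j) * invNorm q (n - j)) := by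
    ext n
    rw [coeff_mk_mul_mk, coeff_mk, invNorm_rec h1 h2 n]
    exact sum_eq_sum_evenCoeff q n fun _ l => invNorm q l
  rw [← hH]
  conv_lhs => rw [hT]
  ring

open PowerSeries in
theorem satisfiesRec_convSeq {q : ℝ} (h1 : q ≠ 1) (h2 : q ≠ -1) :
    SatisfiesRec q (convSeq (invNorm q) (coNorm q)) := by
  intro α
  have hconv : ∀ (a : ℕ → ℝ) (s : ℕ → YoungDiagram → ℝ),
      (PowerSeries.mk fun n => convSeq a s n α) = PowerSeries.mk a * PowerSeries.mk fun n => s n α := by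
    intro a s
    ext n
    rw [coeff_mk_mul_mk, coeff_mk, convSeq, Finset.sum_apply]
    rfl
  have hmul : ∀ a b : ℕ → ℝ, PowerSeries.mk a * PowerSeries.mk b =
      PowerSeries.mk fun n => ∑ k ∈ range (n + 1), a k * b (n - k) := by
    intro a b
    ext n
    rw [coeff_mk_mul_mk, coeff_mk]
  have h3 : (1 - X) * PowerSeries.mk (fun n => convSeq (invNorm q) (coNorm q) n α) =
      PowerSeries.mk (evenCoeff q) *
        PowerSeries.mk fun n => downSeries q (convSeq (invNorm q) (coNorm q)) n α := by
    simp only [downSeries_convSeq]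
    rw [hconv, hconv, ← mul_assoc, ← mul_assoc, one_sub_X_mul_invNorm h1 h2]
    simp only [downSeries_coNorm h1 h2]
  rw [hmul, one_sub_X_mul_mk_eq_iff] at h3
  refine ⟨?_, h3.2⟩
  simp [convSeq, invNorm_zero, coNorm_zero]

theorem skewOp_one_eq {q : ℝ} (h1 : q ≠ 1) (h2 : q ≠ -1) (n : ℕ) (α : YoungDiagram) :
    skewOp q n 1 α = ∑ k ∈ range (n + 1), invNorm q k * coNorm q (n - k) α := by
  have h := congrFun ((satisfiesRec_skewOp_one h1 h2).unique h1 h2 (satisfiesRec_convSeq h1 h2) n) α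
  refine h.trans ?_
  rw [convSeq, Finset.sum_apply]
  rfl

theorem qBinom_eq_zero (q : ℝ) (n : ℕ) : ∀ k, n < k → qBinom q n k = 0 := by
  induction n with
  | zero =>
    intro k hk
    obtain ⟨k, rfl⟩ : ∃ j, k = j + 1 := ⟨k - 1, by omega⟩
    rw [qBinom]
  | succ n ih =>
    intro k hk
    obtain ⟨k, rfl⟩ : ∃ j, k = j + 1 := ⟨k - 1, by omega⟩
    rw [qBinom, ih _ (by omega), ih _ (by omega)]
    ring

theorem qBinom_eq_pochBinom {q : ℝ} (h1 : q ≠ 1) (h2 : q ≠ -1) (n : ℕ) :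
    ∀ r k, r + k = n → qBinom q n r = pochBinom q r k := by
  induction n with
  | zero =>
    intro r k h
    obtain ⟨rfl, rfl⟩ : r = 0 ∧ k = 0 := by omega
    rw [qBinom, pochBinom_zero_left h1 h2]
  | succ n ih =>
    intro r k h
    rcases r with _ | r
    · rw [qBinom, pochBinom_zero_left h1 h2]
    rw [qBinom, ih r k (by omega)]
    rcases k with _ | k
    · rw [qBinom_eq_zero q n _ (by omega), pochBinom_zero_right h1 h2, pochBinom_zero_right h1 h2]
      ring
    · rw [ih (r + 1) k (by omega), pochBinom_succ_succ h1 h2]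

theorem continuous_qBinom (n : ℕ) : ∀ k, Continuous fun q => qBinom q n k := by
  induction n with
  | zero =>
    rintro (_ | k)
    · simp only [qBinom]; exact continuous_const
    · simp only [qBinom]; exact continuous_const
  | succ n ih =>
    rintro (_ | k)
    · simp only [qBinom]; exact continuous_const
    · simp only [qBinom]
      exact (ih k).add ((continuous_pow _).mul (ih _))

theorem continuous_tq (n : ℕ) : Continuous fun q => tq q n :=
  continuous_finsetSum _ fun _ _ => continuous_pow _

theorem continuous_fSkew (m l : YoungDiagram) (n : ℕ) : Continuous fun q => fSkew m l n q :=
  continuous_finsetSum _ fun _ _ => continuous_pow _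

open scoped Classical in
theorem sum_fSkew_of_ne {q : ℝ} (h1 : q ≠ 1) (h2 : q ≠ -1) (α : YoungDiagram) (n : ℕ) :
    ∑ lam ∈ (diagramsOfCard (α.card + n)).filter (fun lam => α ≤ lam), fSkew α lam n q =
      ∑ k ∈ Finset.range (n + 1), qBinom q n k * tq q k *
        ∑ μ ∈ (subDiagrams α).filter (fun μ => μ.card + (n - k) = α.card),
          fSkew μ α (n - k) q := by
  have hn := poch_ne_zero h1 h2 n
  have hL : ∑ lam ∈ (diagramsOfCard (α.card + n)).filter (fun lam => α ≤ lam), fSkew α lam n q =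
      poch q n * skewOp q n 1 α := by
    change _ = poch q n * ∑ l ∈ diagramsOfCard (α.card + n), skewNorm q n α l * 1
    rw [mul_sum, sum_filter]
    refine sum_congr rfl fun l _ => ?_
    rw [skewNorm]
    split_ifs with h
    · field_simp
    · rw [fSkew_eq_zero q n fun h3 => h h3.1]
      ring
  rw [hL, skewOp_one_eq h1 h2, mul_sum]
  refine sum_congr rfl fun k hk => ?_
  rw [mem_range] at hk
  have hk1 := poch_ne_zero h1 h2 k
  have hk2 := poch_ne_zero h1 h2 (n - k)
  have hR : ∑ μ ∈ (subDiagrams α).filter (fun μ => μ.card + (n - k) = α.card),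
      fSkew μ α (n - k) q = poch q (n - k) * coNorm q (n - k) α := by
    rw [coNorm, mul_sum, sum_filter]
    refine sum_congr rfl fun μ _ => ?_
    rw [skewNorm]
    split_ifs with h
    · field_simp
    · rw [fSkew_eq_zero q (n - k) fun h3 => h h3.2.symm]
      ring
  rw [hR, qBinom_eq_pochBinom h1 h2 n k (n - k) (by omega), pochBinom, invNorm,
    show k + (n - k) = n by omega]
  field_simp

open scoped Classical in
/-- For a partition `α` and `n ≥ 0`,
`Σ_{λ/α ⊢ n} f^{λ/α}(q) = Σ_{k ≥ 0} [n choose k]_q t_k(q) Σ_{α/μ ⊢ n-k} f^{α/μ}(q)`. -/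
theorem stmt11 (α : YoungDiagram) (n : ℕ) (q : ℝ) :
    ∑ lam ∈ (diagramsOfCard (α.card + n)).filter (fun lam => α ≤ lam),
        fSkew α lam n q =
      ∑ k ∈ Finset.range (n + 1), qBinom q n k * tq q k *
        ∑ μ ∈ (subDiagrams α).filter (fun μ => μ.card + (n - k) = α.card),
          fSkew μ α (n - k) q := by
  have hdense : Dense ({1, -1}ᶜ : Set ℝ) := (Set.toFinite {1, -1}).countable.dense_compl ℝ
  refine congrFun (Continuous.ext_on hdense (continuous_finsetSum _ fun l _ => continuous_fSkew _ _ _)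
    (continuous_finsetSum _ fun k _ => ((continuous_qBinom n k).mul (continuous_tq k)).mul
      (continuous_finsetSum _ fun μ _ => continuous_fSkew _ _ _)) fun x hx => ?_) q
  simp only [Set.mem_compl_iff, Set.mem_insert_iff, Set.mem_singleton_iff, not_or] at hx
  exact sum_fSkew_of_ne hx.1 hx.2 α n

end QT
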